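/- arXiv:1404.4590 — 3 statements merged into one kernel-verified Lean document; each statement's English description precedes it below -/
import Mathlib

section
/- Let H be a separable infinite-dimensional real Hilbert space and let S = {x ∈ H : ‖x‖ = 1} be its unit sphere, endowed with the metric induced by the norm of H. Then the group of bijective self-isometries of S, endowed with the topology of pointwise convergence, is extremely amenable. -/
universe u

/-- A topological group `G` is extremely amenable if every continuous action of `G` on a
nonempty compact Hausdorff space has a fixed point. -/
def ExtremelyAmenable (G : Type*) [Group G] [TopologicalSpace G] : Prop :=
  ∀ (Y : Type u) [TopologicalSpace Y] [CompactSpace Y] [T2Space Y] [Nonempty Y]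
    [MulAction G Y] [ContinuousSMul G Y], ∃ y : Y, ∀ g : G, g • y = y

/-- The topology of pointwise convergence on the isometry group of a metric space. -/
def isoPointwiseTopology (X : Type*) [MetricSpace X] : TopologicalSpace (X ≃ᵢ X) :=
  TopologicalSpace.induced (fun f : X ≃ᵢ X => (f : X → X)) Pi.topologicalSpace

section Helpers
open MeasureTheory ProbabilityTheory Filter Topology
open scoped NNReal RealInnerProductSpace

theorem pi_absolutelyContinuous {n : ℕ} {μ ν : Fin n → Measure ℝ}
    [∀ i, SigmaFinite (μ i)] [∀ i, SigmaFinite (ν i)] (h : ∀ i, μ i ≪ ν i) :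
    Measure.pi μ ≪ Measure.pi ν := by
  induction n with
  | zero => rw [Measure.pi_of_empty, Measure.pi_of_empty]
  | succ n ih =>
    rw [← (measurePreserving_piFinSuccAbove μ 0).symm.map_eq,
      ← (measurePreserving_piFinSuccAbove ν 0).symm.map_eq]
    exact ((h 0).prod (ih fun i => h _)).map (MeasurableEquiv.measurable _)

section
variable {E : Type*} [NormedAddCommGroup E] [InnerProductSpace ℝ E] [FiniteDimensional ℝ E]
  [MeasurableSpace E] [BorelSpace E]

theorem stdGaussian_absolutelyContinuous : stdGaussian E ≪ volume := by
  have h := ((stdOrthonormalBasis ℝ E).measurePreserving_repr_symm).comp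
    (PiLp.volume_preserving_toLp (Fin (Module.finrank ℝ E)))
  rw [stdGaussian, ← h.map_eq]
  have h2 : (fun x : Fin (Module.finrank ℝ E) → ℝ => ∑ i, x i • stdOrthonormalBasis ℝ E i) =
      (stdOrthonormalBasis ℝ E).repr.symm ∘ WithLp.toLp 2 := by
    ext x
    simp [← OrthonormalBasis.sum_repr_symm]
  rw [h2]
  exact (pi_absolutelyContinuous fun _ =>
    gaussianReal_absolutelyContinuous 0 one_ne_zero).map h.measurable

theorem integral_sq_stdGaussian (L : StrongDual ℝ E) :
    ∫ x, L x ^ 2 ∂stdGaussian E = ‖L‖ ^ 2 := by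
  rw [← variance_dual_stdGaussian L, variance_eq_integral (by fun_prop)]
  simp

theorem integrable_norm_sq_stdGaussian :
    Integrable (fun x : E => ‖x‖ ^ 2) (stdGaussian E) := 
  (IsGaussian.memLp_two_id (μ := stdGaussian E)).integrable_norm_pow two_ne_zero

theorem LipschitzWith.memLp_two_stdGaussian {K : ℝ≥0} {u : E → ℝ} (hu : LipschitzWith K u) :
    MemLp u 2 (stdGaussian E) := by
  have h : MemLp (fun x : E => u x - u 0) 2 (stdGaussian E) :=
    LipschitzWith.comp_memLp (g := fun x : E => u x - u 0) (f := id)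
      (LipschitzWith.of_dist_le_mul fun x y => by simpa using hu.dist_le_mul x y) (by simp)
      IsGaussian.memLp_two_id
  have h0 : MemLp (fun _ : E => u 0) 2 (stdGaussian E) := memLp_const _
  simpa [Pi.add_def] using h.add h0

theorem LipschitzWith.integral_rotate_sub_sq_le_mul {K : ℝ≥0} {u : E → ℝ} (hu : LipschitzWith K u)
    {N : ℕ} (hN : N ≠ 0) :
    ∫ p : E × E, (u p.2 - u p.1) ^ 2 ∂(stdGaussian E).prod (stdGaussian E) ≤
      ∫ p : E × E, (N * (u (Real.cos (Real.pi / (2 * N)) • p.1 + Real.sin (Real.pi / (2 * N)) • p.2)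
        - u p.1)) ^ 2 ∂(stdGaussian E).prod (stdGaussian E) := by
  set γ := stdGaussian E
  set δ := Real.pi / (2 * N) with hδ
  let D : E × E → ℝ := fun p => u (Real.cos δ • p.1 + Real.sin δ • p.2) - u p.1
  have hDc : Continuous D := by have := hu.continuous; fun_prop
  have hrot : ∀ θ, (γ.prod γ).map (ContinuousLinearMap.rotation θ) = γ.prod γ := fun θ =>
    IsGaussian.map_rotation_eq_self (by simp [γ]) θ
  have hDi : Integrable (fun p => D p ^ 2) (γ.prod γ) := by
    have h1 : MemLp (fun p : E × E => u p.1) 2 (γ.prod γ) :=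
      hu.memLp_two_stdGaussian.comp_fst γ
    have h2 : MemLp (fun p : E × E => u (Real.cos δ • p.1 + Real.sin δ • p.2)) 2 (γ.prod γ) := by
      refine MemLp.comp_of_map (f := ContinuousLinearMap.rotation δ)
        (g := fun p : E × E => u p.1) ?_ (by fun_prop)
      rwa [hrot]
    exact (h2.sub h1).integrable_sq
  have hDr : ∀ θ, Integrable (fun p => D (ContinuousLinearMap.rotation θ p) ^ 2) (γ.prod γ) := by
    intro θ
    have := hDi
    rw [← hrot θ] at this
    exact this.comp_aemeasurable (by fun_prop)
  have hDint : ∀ θ, ∫ p, D (ContinuousLinearMap.rotation θ p) ^ 2 ∂γ.prod γ =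
      ∫ p, D p ^ 2 ∂γ.prod γ := by
    intro θ
    conv_rhs => rw [← hrot θ]
    rw [integral_map (by fun_prop) (by fun_prop)]
  have hstep : ∀ (i : ℕ) (p : E × E), D (ContinuousLinearMap.rotation (i * δ) p) =
      u (Real.cos ((i + 1 : ℕ) * δ) • p.1 + Real.sin ((i + 1 : ℕ) * δ) • p.2) -
      u (Real.cos (i * δ) • p.1 + Real.sin (i * δ) • p.2) := by
    intro i p
    simp only [D, ContinuousLinearMap.rotation_apply]
    congr 2
    push_cast
    rw [add_mul, one_mul, Real.cos_add, Real.sin_add]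
    module
  have htel : ∀ p : E × E, u p.2 - u p.1 =
      ∑ i ∈ Finset.range N, D (ContinuousLinearMap.rotation (i * δ) p) := by
    intro p
    simp_rw [hstep]
    rw [Finset.sum_range_sub (fun i : ℕ =>
      u (Real.cos (i * δ) • p.1 + Real.sin (i * δ) • p.2))]
    have : (N : ℝ) * δ = Real.pi / 2 := by rw [hδ]; field_simp
    simp [this]
  calc ∫ p, (u p.2 - u p.1) ^ 2 ∂γ.prod γ
      ≤ ∫ p, N * ∑ i ∈ Finset.range N, D (ContinuousLinearMap.rotation (i * δ) p) ^ 2 ∂γ.prod γ := by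
        refine integral_mono_of_nonneg (ae_of_all _ fun p => sq_nonneg _)
          ((integrable_finsetSum _ fun i _ => hDr _).const_mul _) (ae_of_all _ fun p => ?_)
        simp only [htel]
        simpa using sq_sum_le_card_mul_sum_sq (s := Finset.range N)
          (f := fun i : ℕ => D (ContinuousLinearMap.rotation (i * δ) p))
    _ = ∫ p, (N * D p) ^ 2 ∂γ.prod γ := by
        rw [integral_const_mul, integral_finsetSum _ fun i _ => hDr _]
        simp_rw [hDint, mul_pow, integral_const_mul]
        simp
        ring

theorem LipschitzWith.integral_sub_sq_stdGaussian_le {K : ℝ≥0} {u : E → ℝ}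
    (hu : LipschitzWith K u) :
    ∫ p : E × E, (u p.2 - u p.1) ^ 2 ∂(stdGaussian E).prod (stdGaussian E) ≤
      (Real.pi / 2 * K) ^ 2 := by
  set γ := stdGaussian E
  let δ : ℕ → ℝ := fun N => Real.pi / (2 * N)
  let F : ℕ → E × E → ℝ := fun N p =>
    (N * (u (Real.cos (δ N) • p.1 + Real.sin (δ N) • p.2) - u p.1)) ^ 2
  let G : E × E → ℝ := fun p => (Real.pi / 2 * fderiv ℝ u p.1 p.2) ^ 2
  have huc := hu.continuous
  have hFm : ∀ N, AEStronglyMeasurable (F N) (γ.prod γ) := fun N =>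
    Continuous.aestronglyMeasurable (by fun_prop)
  have hδ : Tendsto δ atTop (𝓝[≠] 0) := by
    refine tendsto_nhdsWithin_iff.2 ⟨?_, ?_⟩
    · exact Tendsto.const_div_atTop
        (tendsto_natCast_atTop_atTop.const_mul_atTop two_pos) _
    · filter_upwards [eventually_ne_atTop 0] with N hN
      have : (N : ℝ) ≠ 0 := by exact_mod_cast hN
      simp [δ, Real.pi_ne_zero, this]
  have hNδ : ∀ᶠ N : ℕ in atTop, (N : ℝ) = Real.pi / 2 * (δ N)⁻¹ := by
    filter_upwards [eventually_ne_atTop 0] with N hN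
    have : (N : ℝ) ≠ 0 := by exact_mod_cast hN
    have := Real.pi_ne_zero
    simp only [δ]
    field_simp
  have hdiff : ∀ᵐ x ∂γ, DifferentiableAt ℝ u x :=
    stdGaussian_absolutelyContinuous.ae_le (hu.ae_differentiableAt (μ := volume))
  have hlim : ∀ᵐ p ∂γ.prod γ, Tendsto (fun N => F N p) atTop (𝓝 (G p)) := by
    filter_upwards [Measure.quasiMeasurePreserving_fst.ae hdiff] with p hp
    refine Tendsto.pow ?_ 2
    have hder : HasDerivAt (fun s : ℝ => u (Real.cos s • p.1 + Real.sin s • p.2))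
        (fderiv ℝ u p.1 p.2) 0 := by
      have h1 : HasDerivAt (fun s : ℝ => Real.cos s • p.1 + Real.sin s • p.2) p.2 0 := by
        have := ((Real.hasDerivAt_cos 0).smul_const p.1).add
          ((Real.hasDerivAt_sin 0).smul_const p.2)
        simpa [Pi.add_def] using this
      have h2 : HasFDerivAt u (fderiv ℝ u p.1) (Real.cos 0 • p.1 + Real.sin 0 • p.2) := by
        simpa using hp.hasFDerivAt
      exact h2.comp_hasDerivAt 0 h1
    have := (hder.tendsto_slope.comp hδ).const_mul (Real.pi / 2)
    refine this.congr' ?_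
    filter_upwards [hNδ] with N hN
    rw [hN]
    simp [slope_def_field]
    ring
  have hbound : ∀ᶠ N : ℕ in atTop, ∀ᵐ p ∂γ.prod γ,
      ‖F N p‖ ≤ 2 * (Real.pi / 2 * K) ^ 2 * (‖p.1‖ ^ 2 + ‖p.2‖ ^ 2) := by
    filter_upwards [hNδ, eventually_ne_atTop 0] with N hN hN0
    refine ae_of_all _ fun p => ?_
    have hN1 : (N : ℝ) ≠ 0 := by exact_mod_cast hN0
    have hδ0 : 0 ≤ δ N := by positivity
    have h1 : ‖Real.cos (δ N) • p.1 + Real.sin (δ N) • p.2 - p.1‖ ≤ δ N * (‖p.1‖ + ‖p.2‖) := by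
      have hc : |Real.cos (δ N) - 1| ≤ δ N := by
        have := Real.abs_cos_sub_cos_le (δ N) 0
        simpa [abs_of_nonneg hδ0] using this
      have hs : |Real.sin (δ N)| ≤ δ N := by
        have := Real.abs_sin_le_abs (x := δ N)
        rwa [abs_of_nonneg hδ0] at this
      calc ‖Real.cos (δ N) • p.1 + Real.sin (δ N) • p.2 - p.1‖
          = ‖(Real.cos (δ N) - 1) • p.1 + Real.sin (δ N) • p.2‖ := by congr 1; module
        _ ≤ |Real.cos (δ N) - 1| * ‖p.1‖ + |Real.sin (δ N)| * ‖p.2‖ := by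
          refine (norm_add_le _ _).trans ?_
          rw [norm_smul, norm_smul, Real.norm_eq_abs, Real.norm_eq_abs]
        _ ≤ δ N * ‖p.1‖ + δ N * ‖p.2‖ := by gcongr
        _ = _ := by ring
    have h2 : |N * (u (Real.cos (δ N) • p.1 + Real.sin (δ N) • p.2) - u p.1)| ≤
        Real.pi / 2 * K * (‖p.1‖ + ‖p.2‖) := by
      have h3 := hu.dist_le_mul (Real.cos (δ N) • p.1 + Real.sin (δ N) • p.2) p.1
      rw [Real.dist_eq, dist_eq_norm] at h3
      rw [abs_mul, Nat.abs_cast]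
      calc N * |u (Real.cos (δ N) • p.1 + Real.sin (δ N) • p.2) - u p.1|
          ≤ N * (K * (δ N * (‖p.1‖ + ‖p.2‖))) :=
            mul_le_mul_of_nonneg_left (h3.trans (mul_le_mul_of_nonneg_left h1 K.2))
              (Nat.cast_nonneg _)
        _ = _ := by simp only [δ]; field_simp
    rw [Real.norm_eq_abs, abs_of_nonneg (sq_nonneg _)]
    calc F N p = |N * (u (Real.cos (δ N) • p.1 + Real.sin (δ N) • p.2) - u p.1)| ^ 2 :=
          (sq_abs _).symm
      _ ≤ (Real.pi / 2 * K * (‖p.1‖ + ‖p.2‖)) ^ 2 := by gcongr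
      _ ≤ _ := by
        rw [mul_pow, mul_comm 2, mul_assoc]
        gcongr
        nlinarith [sq_nonneg (‖p.1‖ - ‖p.2‖)]
  have hbi : Integrable (fun p : E × E => 2 * (Real.pi / 2 * K) ^ 2 * (‖p.1‖ ^ 2 + ‖p.2‖ ^ 2))
      (γ.prod γ) :=
    ((integrable_norm_sq_stdGaussian.comp_fst γ).add
      (integrable_norm_sq_stdGaussian.comp_snd γ)).const_mul _
  have hGm : AEStronglyMeasurable G (γ.prod γ) := aestronglyMeasurable_of_tendsto_ae _ hFm hlim
  have hGle : ∀ p, G p ≤ (Real.pi / 2 * K) ^ 2 * ‖p.2‖ ^ 2 := by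
    intro p
    simp only [G]
    have h1 : |fderiv ℝ u p.1 p.2| ≤ K * ‖p.2‖ :=
      (ContinuousLinearMap.le_opNorm _ _).trans
        (mul_le_mul_of_nonneg_right (norm_fderiv_le_of_lipschitz ℝ hu) (norm_nonneg _))
    rw [← mul_pow, mul_assoc, mul_pow, mul_pow]
    gcongr ?_ * ?_
    exact sq_le_sq' (by linarith [abs_le.1 h1]) (abs_le.1 h1).2
  have hGi : Integrable G (γ.prod γ) :=
    ((integrable_norm_sq_stdGaussian.comp_snd γ).const_mul ((Real.pi / 2 * K) ^ 2)).mono' hGm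
      (ae_of_all _ fun p => by
        rw [Real.norm_eq_abs, abs_of_nonneg (sq_nonneg _)]; exact hGle p)
  have hconv := tendsto_integral_filter_of_dominated_convergence _
    (Eventually.of_forall hFm) hbound hbi hlim
  calc _ ≤ ∫ p, G p ∂γ.prod γ := by
        refine ge_of_tendsto hconv ?_
        filter_upwards [eventually_ne_atTop 0] with N hN
        exact hu.integral_rotate_sub_sq_le_mul hN
    _ = ∫ x, (Real.pi / 2) ^ 2 * ‖fderiv ℝ u x‖ ^ 2 ∂γ := by
        rw [integral_prod _ hGi]
        simp only [G, mul_pow, integral_const_mul, γ, integral_sq_stdGaussian]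
    _ ≤ ∫ _, (Real.pi / 2 * K) ^ 2 ∂γ := by
        refine integral_mono_of_nonneg (ae_of_all _ fun x => by positivity) (integrable_const _)
          (ae_of_all _ fun x => ?_)
        simp only [mul_pow]
        gcongr
        exact norm_fderiv_le_of_lipschitz ℝ hu
    _ = _ := by simp

/-- The Gaussian Poincaré inequality for Lipschitz functions, up to the value of the constant. -/
theorem LipschitzWith.integral_sub_mean_sq_stdGaussian_le {K : ℝ≥0} {u : E → ℝ}
    (hu : LipschitzWith K u) :
    ∫ x, (u x - ∫ y, u y ∂stdGaussian E) ^ 2 ∂stdGaussian E ≤ (Real.pi / 2 * K) ^ 2 := by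
  set γ := stdGaussian E
  set m := ∫ y, u y ∂γ with hm
  have h2 : MemLp (fun x => u x - m) 2 γ := hu.memLp_two_stdGaussian.sub (memLp_const m)
  have h1 : Integrable (fun x => u x - m) γ := h2.integrable one_le_two
  have h0 : ∫ x, (u x - m) ∂γ = 0 := by
    rw [integral_sub (hu.memLp_two_stdGaussian.integrable one_le_two) (integrable_const _)]
    simp [hm, γ]
  have key : ∫ p : E × E, (u p.2 - u p.1) ^ 2 ∂γ.prod γ = 2 * ∫ x, (u x - m) ^ 2 ∂γ := by
    have h3 : ∀ p : E × E, (u p.2 - u p.1) ^ 2 =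
        (u p.2 - m) ^ 2 + (u p.1 - m) ^ 2 - 2 * ((u p.1 - m) * (u p.2 - m)) := fun p => by ring
    simp_rw [h3]
    have ha : Integrable (fun p : E × E => (u p.2 - m) ^ 2) (γ.prod γ) :=
      h2.integrable_sq.comp_snd γ
    have hb : Integrable (fun p : E × E => (u p.1 - m) ^ 2) (γ.prod γ) :=
      h2.integrable_sq.comp_fst γ
    rw [integral_sub (f := fun p : E × E => (u p.2 - m) ^ 2 + (u p.1 - m) ^ 2) (ha.add hb)
        ((h1.mul_prod h1).const_mul 2), integral_add ha hb,
      integral_const_mul, integral_prod_mul (fun x => u x - m) (fun x => u x - m), h0,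
      integral_fun_snd (fun x => (u x - m) ^ 2), integral_fun_fst (fun x => (u x - m) ^ 2)]
    simp
    ring
  have := hu.integral_sub_sq_stdGaussian_le
  have hnn : 0 ≤ ∫ x, (u x - m) ^ 2 ∂γ := integral_nonneg fun x => sq_nonneg _
  linarith

end


theorem tendsto_norm_of_tendsto_sub {G : Type*} [SeminormedAddCommGroup G] {x y : ℕ → G} {c : ℝ}
    (hy : Tendsto (fun n => ‖y n‖) atTop (𝓝 c)) (h : Tendsto (fun n => x n - y n) atTop (𝓝 0)) :
    Tendsto (fun n => ‖x n‖) atTop (𝓝 c) := by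
  have h1 : Tendsto (fun n => ‖x n‖ - ‖y n‖) atTop (𝓝 0) :=
    squeeze_zero_norm (fun n => abs_norm_sub_norm_le _ _) (by simpa using h.norm)
  simpa using h1.add hy

section
variable {H : Type*} [NormedAddCommGroup H] [InnerProductSpace ℝ H]

/-- Two finite families with the same Gram matrix are related by a linear isometry, which can be
taken to be a product of reflections. -/
theorem exists_linearIsometryEquiv_map_eq {I : Type*} [Finite I] {v w : I → H}
    (h : ∀ i j, ⟪w i, w j⟫ = ⟪v i, v j⟫) : ∃ T : H ≃ₗᵢ[ℝ] H, ∀ i, T (v i) = w i := by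
  classical
  have := Fintype.ofFinite I
  suffices ∀ s : Finset I, ∃ T : H ≃ₗᵢ[ℝ] H, ∀ i ∈ s, T (v i) = w i by
    simpa using this Finset.univ
  intro s
  induction s using Finset.induction_on with
  | empty => exact ⟨LinearIsometryEquiv.refl ℝ H, by simp⟩
  | insert a s _ ih =>
    obtain ⟨T, hT⟩ := ih
    have hn : ‖T (v a)‖ = ‖w a‖ := by
      rw [T.norm_map, norm_eq_sqrt_real_inner, norm_eq_sqrt_real_inner, h]
    refine ⟨T.trans (ℝ ∙ (T (v a) - w a))ᗮ.reflection, fun i hi => ?_⟩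
    rw [LinearIsometryEquiv.trans_apply]
    rcases Finset.mem_insert.1 hi with rfl | hi
    · exact Submodule.reflection_sub hn
    · rw [hT i hi, Submodule.reflection_eq_self_iff,
        Submodule.mem_orthogonal_singleton_iff_inner_right, inner_sub_left, h,
        ← hT i hi, T.inner_map_map, sub_self]

theorem exists_orthonormal_nat (hinf : ¬ FiniteDimensional ℝ H) :
    ∃ b : ℕ → H, Orthonormal ℝ b := by
  let B := Module.Basis.ofVectorSpace ℝ H
  have : Infinite (Module.Basis.ofVectorSpaceIndex ℝ H) := by
    by_contra hfin
    rw [not_infinite_iff_finite] at hfin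
    exact hinf B.finiteDimensional_of_finite
  exact ⟨_, InnerProductSpace.gramSchmidtNormed_orthonormal
    (B.linearIndependent.comp _ (Infinite.natEmbedding _).injective)⟩

section GramSchmidt

open InnerProductSpace

variable {m : ℕ} {a : ℕ → Fin m → H}

theorem tendsto_norm_of_tendsto_inner_self {x : ℕ → H}
    (h : Tendsto (fun n => ⟪x n, x n⟫) atTop (𝓝 1)) : Tendsto (fun n => ‖x n‖) atTop (𝓝 1) := by
  simp_rw [norm_eq_sqrt_real_inner]
  simpa using h.sqrt

theorem tendsto_gramSchmidt_sub
    (ha : ∀ i j, Tendsto (fun n => ⟪a n i, a n j⟫) atTop (𝓝 (if i = j then 1 else 0)))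
    (i : Fin m) : Tendsto (fun n => gramSchmidt ℝ (a n) i - a n i) atTop (𝓝 0) := by
  have hnorm : ∀ i, Tendsto (fun n => ‖a n i‖) atTop (𝓝 1) := fun i =>
    tendsto_norm_of_tendsto_inner_self (by simpa using ha i i)
  induction i using WellFoundedLT.induction with
  | ind i ih =>
  have hgs : ∀ j < i, Tendsto (fun n => ‖gramSchmidt ℝ (a n) j‖) atTop (𝓝 1) := fun j hj =>
    tendsto_norm_of_tendsto_sub (hnorm j) (ih j hj)
  have hinner : ∀ j < i, Tendsto (fun n => ⟪gramSchmidt ℝ (a n) j, a n i⟫) atTop (𝓝 0) := by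
    intro j hj
    have h1 : Tendsto (fun n => ⟪gramSchmidt ℝ (a n) j - a n j, a n i⟫) atTop (𝓝 0) := by
      refine squeeze_zero_norm (fun n => norm_inner_le_norm _ _) ?_
      simpa using (ih j hj).norm.mul (hnorm i)
    have h2 := h1.add (ha j i)
    simpa [inner_sub_left, hj.ne] using h2
  have h : ∀ n, gramSchmidt ℝ (a n) i - a n i = -∑ j ∈ Finset.Iio i,
      (⟪gramSchmidt ℝ (a n) j, a n i⟫ / ‖gramSchmidt ℝ (a n) j‖ ^ 2) •
        gramSchmidt ℝ (a n) j := fun n => by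
    conv_lhs => rw [gramSchmidt_def'' ℝ (a n) i]
    simp
  simp_rw [h]
  rw [← neg_zero, ← Finset.sum_const_zero (s := Finset.Iio i)]
  refine (tendsto_finsetSum _ fun j hj => ?_).neg
  have hj := Finset.mem_Iio.1 hj
  rw [tendsto_zero_iff_norm_tendsto_zero]
  have := (((hinner j hj).norm).div ((hgs j hj).pow 2) (by norm_num)).mul (hgs j hj)
  simpa [norm_smul] using this

theorem exists_orthonormal_tendsto_sub
    (ha : ∀ i j, Tendsto (fun n => ⟪a n i, a n j⟫) atTop (𝓝 (if i = j then 1 else 0))) :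
    ∃ t : ℕ → Fin m → H, (∀ᶠ n in atTop, Orthonormal ℝ (t n)) ∧
      ∀ i, Tendsto (fun n => t n i - a n i) atTop (𝓝 0) := by
  have hgs := tendsto_gramSchmidt_sub ha
  have hnorm : ∀ i, Tendsto (fun n => ‖gramSchmidt ℝ (a n) i‖) atTop (𝓝 1) := fun i =>
    tendsto_norm_of_tendsto_sub (tendsto_norm_of_tendsto_inner_self (by simpa using ha i i))
      (hgs i)
  refine ⟨fun n => gramSchmidtNormed ℝ (a n), ?_, fun i => ?_⟩
  · have h : ∀ᶠ n in atTop, ∀ i, ‖gramSchmidt ℝ (a n) i‖ ≠ 0 :=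
      eventually_all.2 fun i => (hnorm i).eventually_ne one_ne_zero
    filter_upwards [h] with n hn
    refine ⟨fun i => by
      simp [gramSchmidtNormed, norm_smul, hn i],
      fun i j hij => ?_⟩
    simp [gramSchmidtNormed, inner_smul_left, inner_smul_right, gramSchmidt_orthogonal ℝ _ hij]
  · have h1 : Tendsto (fun n => gramSchmidtNormed ℝ (a n) i - gramSchmidt ℝ (a n) i) atTop
        (𝓝 0) := by
      rw [tendsto_zero_iff_norm_tendsto_zero]
      have h2 := ((((hnorm i).inv₀ one_ne_zero).sub_const 1).norm).mul (hnorm i)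
      have h3 : ∀ n, gramSchmidtNormed ℝ (a n) i - gramSchmidt ℝ (a n) i =
          (‖gramSchmidt ℝ (a n) i‖⁻¹ - 1) • gramSchmidt ℝ (a n) i := fun n => by
        simp [gramSchmidtNormed, sub_smul]
      simp_rw [h3, norm_smul]
      simpa using h2
    simpa using h1.add (hgs i)

end GramSchmidt
end

section
variable {H : Type*} [NormedAddCommGroup H] [InnerProductSpace ℝ H]
  {E : Type*} [NormedAddCommGroup E] [InnerProductSpace ℝ E]

/-- The normalized random linear map `E → H` with rows `ω l` along the orthonormal family `b`. -/
noncomputable def rowMap (b : ℕ → H) (n : ℕ) (ω : PiLp 2 fun _ : Fin n => E) : E →ₗ[ℝ] H :=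
  (√n)⁻¹ • ∑ l, (innerₛₗ ℝ (ω l)).smulRight (b l)

theorem rowMap_apply (b : ℕ → H) (n : ℕ) (ω : PiLp 2 fun _ : Fin n => E) (c : E) :
    rowMap b n ω c = (√n)⁻¹ • ∑ l, ⟪ω l, c⟫ • b l := by
  simp [rowMap]

theorem rowMap_sub (b : ℕ → H) (n : ℕ) (ω ω' : PiLp 2 fun _ : Fin n => E) (c : E) :
    rowMap b n (ω - ω') c = rowMap b n ω c - rowMap b n ω' c := by
  simp [rowMap_apply, inner_sub_left, sub_smul, smul_sub]

theorem norm_sq_rowMap {b : ℕ → H} (hb : Orthonormal ℝ b) (n : ℕ)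
    (ω : PiLp 2 fun _ : Fin n => E) (c : E) :
    ‖rowMap b n ω c‖ ^ 2 = (n : ℝ)⁻¹ * ∑ l, ⟪ω l, c⟫ ^ 2 := by
  have hb' : Orthonormal ℝ fun l : Fin n => b l := hb.comp _ Fin.val_injective
  rw [rowMap_apply, norm_smul, mul_pow, ← real_inner_self_eq_norm_sq (∑ l, ⟪ω l, c⟫ • b l),
    hb'.inner_sum]
  simp [← sq]

theorem norm_rowMap_le {b : ℕ → H} (hb : Orthonormal ℝ b) (n : ℕ)
    (ω : PiLp 2 fun _ : Fin n => E) (c : E) :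
    ‖rowMap b n ω c‖ ≤ (√n)⁻¹ * ‖c‖ * ‖ω‖ := by
  refine abs_le_of_sq_le_sq' ?_ (by positivity) |>.2
  rw [norm_sq_rowMap hb, mul_pow, mul_pow, inv_pow, Real.sq_sqrt (Nat.cast_nonneg n),
    PiLp.norm_sq_eq_of_L2, mul_assoc]
  refine mul_le_mul_of_nonneg_left ?_ (by positivity)
  rw [Finset.mul_sum]
  refine Finset.sum_le_sum fun l _ => ?_
  rw [← mul_pow, mul_comm]
  exact sq_le_sq' (abs_le.1 (abs_real_inner_le_norm _ _)).1
    (abs_le.1 (abs_real_inner_le_norm _ _)).2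

theorem lipschitzWith_rowMap {b : ℕ → H} (hb : Orthonormal ℝ b) (n : ℕ) {I : Type*} [Fintype I]
    {v : I → E} {R : ℝ≥0} (hv : ∀ i, ‖v i‖ ≤ R) :
    LipschitzWith ((NNReal.sqrt n)⁻¹ * R)
      (fun (ω : PiLp 2 fun _ : Fin n => E) i => rowMap b n ω (v i)) := by
  refine LipschitzWith.of_dist_le_mul fun ω ω' => ?_
  refine (dist_pi_le_iff (by positivity)).2 fun i => ?_
  rw [dist_eq_norm, dist_eq_norm, ← rowMap_sub]
  refine (norm_rowMap_le hb n _ _).trans ?_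
  push_cast
  gcongr
  exact hv i

variable [FiniteDimensional ℝ E] [MeasurableSpace E] [BorelSpace E]

theorem integral_norm_sq_rowMap {b : ℕ → H} (hb : Orthonormal ℝ b) {n : ℕ} (hn : n ≠ 0) (c : E) :
    ∫ ω, ‖rowMap b n ω c‖ ^ 2 ∂stdGaussian (PiLp 2 fun _ : Fin n => E) = ‖c‖ ^ 2 := by
  let L : Fin n → StrongDual ℝ (PiLp 2 fun _ : Fin n => E) := fun l =>
    innerSL ℝ (PiLp.single 2 l c)
  have hL : ∀ l ω, ⟪ω l, c⟫ = L l ω := fun l ω => by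
    simp only [L, innerSL_apply_apply, PiLp.inner_apply]
    rw [Finset.sum_eq_single l (fun k _ hk => by simp [hk]) (by simp)]
    simp [real_inner_comm]
  have hLn : ∀ l, ‖L l‖ = ‖c‖ := fun l => by simp [L]
  simp_rw [norm_sq_rowMap hb, hL, integral_const_mul]
  rw [integral_finsetSum]
  · simp_rw [integral_sq_stdGaussian, hLn]
    simp [hn]
  · intro l _
    exact ((L l).lipschitz.memLp_two_stdGaussian).integrable_sq

theorem integral_norm_rowMap_sub_sq_le {b : ℕ → H} (hb : Orthonormal ℝ b) {n : ℕ} (hn : n ≠ 0)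
    (c : E) :
    ∫ ω, (‖rowMap b n ω c‖ - ‖c‖) ^ 2 ∂stdGaussian (PiLp 2 fun _ : Fin n => E) ≤
      2 * (Real.pi / 2 * ‖c‖) ^ 2 * (n : ℝ)⁻¹ := by
  set γ := stdGaussian (PiLp 2 fun _ : Fin n => E) with hγ
  have hu : LipschitzWith ((NNReal.sqrt n)⁻¹ * ‖c‖₊) fun ω : PiLp 2 fun _ : Fin n => E =>
      ‖rowMap b n ω c‖ := by
    have h1 := (LipschitzWith.eval (α := fun _ : Unit => H) ()).comp
      (lipschitzWith_rowMap hb n (v := fun _ : Unit => c) (R := ‖c‖₊) fun _ => le_rfl)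
    simpa [Function.comp_def] using lipschitzWith_one_norm.comp h1
  have hL2 := hu.memLp_two_stdGaussian
  have hi := hL2.integrable one_le_two
  have hi2 := hL2.integrable_sq
  have hvar := hu.integral_sub_mean_sq_stdGaussian_le
  have hsq := integral_norm_sq_rowMap hb hn c
  rw [← hγ] at hL2 hi hi2 hvar hsq
  set m := ∫ ω, ‖rowMap b n ω c‖ ∂γ
  have hm : 0 ≤ m := integral_nonneg fun _ => norm_nonneg _
  have hexp : ∀ r : ℝ, ∫ ω, (‖rowMap b n ω c‖ - r) ^ 2 ∂γ = ‖c‖ ^ 2 - 2 * r * m + r ^ 2 := by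
    intro r
    have h : ∀ ω, (‖rowMap b n ω c‖ - r) ^ 2 =
        ‖rowMap b n ω c‖ ^ 2 - 2 * r * ‖rowMap b n ω c‖ + r ^ 2 := fun ω => by ring
    simp_rw [h]
    rw [integral_add (f := fun ω => ‖rowMap b n ω c‖ ^ 2 - 2 * r * ‖rowMap b n ω c‖)
      (hi2.sub (hi.const_mul _)) (integrable_const _), integral_sub hi2 (hi.const_mul _),
      integral_const_mul, hsq]
    simp [m]
  have hvnn : 0 ≤ ∫ ω, (‖rowMap b n ω c‖ - m) ^ 2 ∂γ := integral_nonneg fun _ => sq_nonneg _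
  rw [hexp] at hvar hvnn ⊢
  have hmc : m ≤ ‖c‖ := abs_le_of_sq_le_sq' (by linarith) (norm_nonneg c) |>.2
  have hK : (Real.pi / 2 * ((NNReal.sqrt n)⁻¹ * ‖c‖₊ : ℝ≥0)) ^ 2 =
      (Real.pi / 2 * ‖c‖) ^ 2 * (n : ℝ)⁻¹ := by
    push_cast
    rw [mul_pow, mul_pow, mul_pow, inv_pow, Real.sq_sqrt (Nat.cast_nonneg n)]
    ring
  rw [hK] at hvar
  nlinarith [mul_nonneg hm (sub_nonneg.2 hmc)]

theorem integral_comp_rowMap_eq (b : ℕ → H) (n : ℕ) {I : Type*} (f : (I → H) → ℝ) {v w : I → E}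
    (Q : E ≃ₗᵢ[ℝ] E) (hQ : ∀ i, Q (v i) = w i) :
    ∫ ω, f (fun i => rowMap b n ω (w i)) ∂stdGaussian (PiLp 2 fun _ : Fin n => E) =
      ∫ ω, f (fun i => rowMap b n ω (v i)) ∂stdGaussian (PiLp 2 fun _ : Fin n => E) := by
  let Q' := LinearIsometryEquiv.piLpCongrRight 2 fun _ : Fin n => Q
  have hmap : ∫ ω, f (fun i => rowMap b n ω (w i)) ∂stdGaussian (PiLp 2 fun _ : Fin n => E) =
      ∫ ω, f (fun i => rowMap b n (Q' ω) (w i)) ∂stdGaussian (PiLp 2 fun _ : Fin n => E) := by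
    conv_lhs => rw [← stdGaussian_map Q']
    exact Q'.toHomeomorph.measurableEmbedding.integral_map _
  rw [hmap]
  congr! 4 with ω i
  simp [rowMap_apply, Q', ← hQ]

theorem memLp_comp_rowMap {b : ℕ → H} (hb : Orthonormal ℝ b) (n : ℕ) {I : Type*} [Fintype I]
    {f : (I → H) → ℝ} {K : ℝ≥0} (hf : LipschitzWith K f) (v : I → E) :
    MemLp (fun ω => f fun i => rowMap b n ω (v i)) 2
      (stdGaussian (PiLp 2 fun _ : Fin n => E)) :=
  (hf.comp (lipschitzWith_rowMap hb n (R := ∑ i, ‖v i‖₊) fun i => by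
    exact_mod_cast Finset.single_le_sum (f := fun i => ‖v i‖₊) (fun _ _ => zero_le)
      (Finset.mem_univ i))).memLp_two_stdGaussian

theorem integral_comp_rowMap_sub_sq_le {b : ℕ → H} (hb : Orthonormal ℝ b) (n : ℕ)
    {I : Type*} [Fintype I] {f : (I → H) → ℝ} {K : ℝ≥0} (hf : LipschitzWith K f) {v w : I → E}
    (hvw : ∀ i j, ⟪w i, w j⟫ = ⟪v i, v j⟫) {R : ℝ≥0} (hR : ∀ i, ‖v i‖ ≤ R) :
    ∫ ω, (f (fun i => rowMap b n ω (w i)) - f (fun i => rowMap b n ω (v i))) ^ 2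
      ∂stdGaussian (PiLp 2 fun _ : Fin n => E) ≤
      4 * (Real.pi / 2 * (K * R)) ^ 2 * (n : ℝ)⁻¹ := by
  set γ := stdGaussian (PiLp 2 fun _ : Fin n => E) with hγ
  have hR' : ∀ i, ‖w i‖ ≤ R := fun i => by
    rw [norm_eq_sqrt_real_inner, hvw, ← norm_eq_sqrt_real_inner]
    exact hR i
  obtain ⟨Q, hQ⟩ := exists_linearIsometryEquiv_map_eq hvw
  have hmean := integral_comp_rowMap_eq b n f Q hQ
  have hv := (hf.comp (lipschitzWith_rowMap hb n hR)).integral_sub_mean_sq_stdGaussian_le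
  have hw := (hf.comp (lipschitzWith_rowMap hb n hR')).integral_sub_mean_sq_stdGaussian_le
  simp only [Function.comp_def] at hv hw
  rw [hmean] at hw
  rw [← hγ] at hv hw
  set m := ∫ ω, f (fun i => rowMap b n ω (v i)) ∂γ
  have hiv : Integrable (fun ω => (f (fun i => rowMap b n ω (v i)) - m) ^ 2) γ :=
    ((memLp_comp_rowMap hb n hf v).sub (memLp_const m)).integrable_sq
  have hiw : Integrable (fun ω => (f (fun i => rowMap b n ω (w i)) - m) ^ 2) γ :=
    ((memLp_comp_rowMap hb n hf w).sub (memLp_const m)).integrable_sq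
  have hK : (Real.pi / 2 * (K * ((NNReal.sqrt n)⁻¹ * R) : ℝ≥0)) ^ 2 =
      (Real.pi / 2 * (K * R)) ^ 2 * (n : ℝ)⁻¹ := by
    push_cast
    simp only [mul_pow, inv_pow, Real.sq_sqrt (Nat.cast_nonneg n)]
    ring
  rw [hK] at hv hw
  calc _ ≤ ∫ ω, (2 * (f (fun i => rowMap b n ω (w i)) - m) ^ 2 +
          2 * (f (fun i => rowMap b n ω (v i)) - m) ^ 2) ∂γ := by
        refine integral_mono_of_nonneg (ae_of_all _ fun _ => sq_nonneg _)
          ((hiw.const_mul 2).add (hiv.const_mul 2)) (ae_of_all _ fun ω => ?_)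
        simp only
        nlinarith [sq_nonneg (f (fun i => rowMap b n ω (w i)) - m +
          (f (fun i => rowMap b n ω (v i)) - m))]
    _ ≤ _ := by
        rw [integral_add (hiw.const_mul 2) (hiv.const_mul 2), integral_const_mul,
          integral_const_mul]
        linarith

end

theorem exists_seq_tendsto_zero_of_integral_sq_le {Ω : ℕ → Type*} [∀ n, MeasurableSpace (Ω n)]
    (μ : ∀ n, Measure (Ω n)) [∀ n, IsProbabilityMeasure (μ n)] {J : Type*} [Finite J]
    {g : J → ∀ n, Ω n → ℝ} (hg : ∀ j n, MemLp (g j n) 2 (μ n)) {C : J → ℝ}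
    (hC : ∀ j n, n ≠ 0 → ∫ ω, g j n ω ^ 2 ∂μ n ≤ C j * (n : ℝ)⁻¹) :
    ∃ ω : ∀ n, Ω n, ∀ j, Tendsto (fun n => g j n (ω n)) atTop (𝓝 0) := by
  have := Fintype.ofFinite J
  have hi : ∀ n, Integrable (fun ω => ∑ j, g j n ω ^ 2) (μ n) := fun n =>
    integrable_finsetSum _ fun j _ => (hg j n).integrable_sq
  choose ω hω using fun n => exists_le_integral (hi n)
  refine ⟨ω, fun j => ?_⟩
  have hsq : Tendsto (fun n => g j n (ω n) ^ 2) atTop (𝓝 0) := by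
    have hlim : Tendsto (fun n : ℕ => (∑ j, C j) * (n : ℝ)⁻¹) atTop (𝓝 0) := by
      simpa using (tendsto_inv_atTop_nhds_zero_nat (𝕜 := ℝ)).const_mul (∑ j, C j)
    refine squeeze_zero' (Eventually.of_forall fun _ => sq_nonneg _) ?_ hlim
    filter_upwards [eventually_ne_atTop 0] with n hn
    calc g j n (ω n) ^ 2 ≤ ∑ j, g j n (ω n) ^ 2 :=
          Finset.single_le_sum (f := fun j => g j n (ω n) ^ 2) (fun _ _ => sq_nonneg _)
            (Finset.mem_univ j)
      _ ≤ _ := hω n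
      _ = ∑ j, ∫ ω, g j n ω ^ 2 ∂μ n := integral_finsetSum _ fun j _ => (hg j n).integrable_sq
      _ ≤ ∑ j, C j * (n : ℝ)⁻¹ := Finset.sum_le_sum fun j _ => hC j n hn
      _ = _ := by rw [Finset.sum_mul]
  have := hsq.sqrt
  simp_rw [Real.sqrt_sq_eq_abs, Real.sqrt_zero] at this
  exact tendsto_zero_iff_abs_tendsto_zero _ |>.2 this

section
variable {H : Type*} [NormedAddCommGroup H] [InnerProductSpace ℝ H]

theorem exists_linearMap_seq {E : Type*} [NormedAddCommGroup E] [InnerProductSpace ℝ E]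
    [FiniteDimensional ℝ E] {b : ℕ → H} (hb : Orthonormal ℝ b) {ι I J : Type*} [Finite ι]
    [Fintype I] [Finite J] {f : ι → (I → H) → ℝ} {K : ι → ℝ≥0} (hf : ∀ i, LipschitzWith (K i) (f i))
    {v : I → E} {w : ι → I → E} (hvw : ∀ i j k, ⟪w i j, w i k⟫ = ⟪v j, v k⟫) (c : J → E) :
    ∃ A : ℕ → E →ₗ[ℝ] H,
      (∀ i, Tendsto (fun n => f i (fun j => A n (w i j)) - f i (fun j => A n (v j))) atTop (𝓝 0)) ∧
      ∀ j, Tendsto (fun n => ‖A n (c j)‖) atTop (𝓝 ‖c j‖) := by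
  borelize E
  have hR : ∀ i, ‖v i‖ ≤ (∑ i, ‖v i‖₊ : ℝ≥0) := fun i => by
    exact_mod_cast Finset.single_le_sum (f := fun i => ‖v i‖₊) (fun _ _ => zero_le)
      (Finset.mem_univ i)
  obtain ⟨ω, hω⟩ := exists_seq_tendsto_zero_of_integral_sq_le (J := ι ⊕ J)
    (fun n => stdGaussian (PiLp 2 fun _ : Fin n => E))
    (g := fun j n ω => Sum.elim
      (fun i => f i (fun j => rowMap b n ω (w i j)) - f i (fun j => rowMap b n ω (v j)))
      (fun j => ‖rowMap b n ω (c j)‖ - ‖c j‖) j)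
    (C := Sum.elim (fun i => 4 * (Real.pi / 2 * (K i * (∑ i, ‖v i‖₊ : ℝ≥0))) ^ 2)
      (fun j => 2 * (Real.pi / 2 * ‖c j‖) ^ 2))
    (by
      rintro (i | j) n
      · exact (memLp_comp_rowMap hb n (hf i) (w i)).sub (memLp_comp_rowMap hb n (hf i) v)
      · exact (memLp_comp_rowMap hb n (I := Unit) (f := fun z => ‖z ()‖) (K := 1)
          (LipschitzWith.of_dist_le_mul fun x y => by
            simpa using (dist_norm_norm_le _ _).trans
              ((dist_eq_norm (x ()) (y ())).symm.le.trans (dist_le_pi_dist x y ())))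
          fun _ => c j).sub (memLp_const _))
    (by
      rintro (i | j) n hn
      · exact integral_comp_rowMap_sub_sq_le hb n (hf i) (hvw i) hR
      · exact integral_norm_rowMap_sub_sq_le hb hn (c j))
  refine ⟨fun n => rowMap b n (ω n), fun i => hω (.inl i), fun j => ?_⟩
  simpa using (hω (.inr j)).add_const ‖c j‖

end

section
variable {H : Type*} [NormedAddCommGroup H] [InnerProductSpace ℝ H]

theorem real_inner_eq_norm_add_sq_sub (x y : H) :
    ⟪x, y⟫ = (‖x + y‖ ^ 2 - ‖x + x‖ ^ 2 / 4 - ‖y + y‖ ^ 2 / 4) / 2 := by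
  rw [← two_smul ℝ x, ← two_smul ℝ y, norm_smul, norm_smul, norm_add_sq_real]
  norm_num
  ring

theorem tendsto_inner_of_tendsto_norm_add {m : ℕ} {a : ℕ → Fin m → H} {E : Type*}
    [NormedAddCommGroup E] [InnerProductSpace ℝ E] {e : Fin m → E}
    (h : ∀ i j, Tendsto (fun n => ‖a n i + a n j‖) atTop (𝓝 ‖e i + e j‖)) (i j : Fin m) :
    Tendsto (fun n => ⟪a n i, a n j⟫) atTop (𝓝 ⟪e i, e j⟫) := by
  simp_rw [real_inner_eq_norm_add_sq_sub]
  exact ((((h i j).pow 2).sub (((h i i).pow 2).div_const 4)).sub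
    (((h j j).pow 2).div_const 4)).div_const 2

theorem exists_linearIsometryEquiv_abs_sub_lt [CompleteSpace H] (hinf : ¬ FiniteDimensional ℝ H)
    {ι I : Type*} [Finite ι] [Fintype I] {f : ι → (I → H) → ℝ} {K : ι → ℝ≥0}
    (hf : ∀ i, LipschitzWith (K i) (f i)) {v : I → H} {w : ι → I → H}
    (hvw : ∀ i j k, ⟪w i j, w i k⟫ = ⟪v j, v k⟫) {ε : ι → ℝ} (hε : ∀ i, 0 < ε i) :
    ∃ T : H ≃ₗᵢ[ℝ] H, ∀ i, |f i (fun j => T (w i j)) - f i (fun j => T (v j))| < ε i := by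
  obtain ⟨b, hb⟩ := exists_orthonormal_nat hinf
  let E : Submodule ℝ H := Submodule.span ℝ (Set.range v ∪ ⋃ i, Set.range (w i))
  have hvE : ∀ j, v j ∈ E := fun j => Submodule.subset_span (.inl ⟨j, rfl⟩)
  have hwE : ∀ i j, w i j ∈ E := fun i j =>
    Submodule.subset_span (.inr (Set.mem_iUnion.2 ⟨i, j, rfl⟩))
  have : FiniteDimensional ℝ E := FiniteDimensional.span_of_finite ℝ
    ((Set.finite_range v).union (Set.finite_iUnion fun i => Set.finite_range (w i)))
  let e := stdOrthonormalBasis ℝ E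
  obtain ⟨A, hA, hAn⟩ := exists_linearMap_seq hb hf (v := fun j => (⟨v j, hvE j⟩ : E))
    (w := fun i j => (⟨w i j, hwE i j⟩ : E)) (fun i j k => hvw i j k)
    (fun p : Fin (Module.finrank ℝ E) × Fin (Module.finrank ℝ E) => e p.1 + e p.2)
  obtain ⟨t, ht, hta⟩ := exists_orthonormal_tendsto_sub (H := H)
      (a := fun n j => A n (e j)) fun i j => by
    rw [← orthonormal_iff_ite.1 e.orthonormal i j]
    refine tendsto_inner_of_tendsto_norm_add (a := fun n j => A n (e j)) (e := e)
      (fun i j => ?_) i j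
    simpa using hAn (i, j)
  have heH : Orthonormal ℝ fun j => (e j : H) :=
    e.orthonormal.comp_linearIsometry E.subtypeₗᵢ
  have hex : ∀ n, ∃ T : H ≃ₗᵢ[ℝ] H, Orthonormal ℝ (t n) → ∀ j, T (e j) = t n j := fun n => by
    by_cases hn : Orthonormal ℝ (t n)
    · obtain ⟨T, hT⟩ := exists_linearIsometryEquiv_map_eq (v := fun j => (e j : H)) (w := t n)
        fun i j => by rw [orthonormal_iff_ite.1 hn, orthonormal_iff_ite.1 heH]
      exact ⟨T, fun _ => hT⟩
    · exact ⟨.refl ℝ H, fun h => absurd h hn⟩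
  choose T hT using hex
  have hTA : ∀ x : E, Tendsto (fun n => T n x - A n x) atTop (𝓝 0) := fun x => by
    have hsum : Tendsto (fun n => ∑ j, e.repr x j • (t n j - A n (e j))) atTop (𝓝 0) := by
      simpa using tendsto_finsetSum Finset.univ fun j _ => (hta j).const_smul (e.repr x j)
    refine hsum.congr' ?_
    filter_upwards [ht] with n hn
    conv_rhs => rw [← e.sum_repr x]
    simp [smul_sub, hT n hn]
  have hlim : ∀ i (z : I → E),
      Tendsto (fun n => f i (fun j => T n (z j)) - f i (fun j => A n (z j)))
      atTop (𝓝 0) := fun i z => by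
    have h1 : Tendsto (fun n => (K i : ℝ) * ‖fun j => T n (z j) - A n (z j)‖) atTop (𝓝 0) := by
      have := (tendsto_pi_nhds (f := fun n j => T n (z j) - A n (z j)) (g := 0)).2
        fun j => hTA (z j)
      simpa using this.norm.const_mul (K i : ℝ)
    refine squeeze_zero_norm (fun n => ?_) h1
    rw [← dist_eq_norm]
    refine ((hf i).dist_le_mul _ _).trans_eq ?_
    rw [dist_eq_norm]
    rfl
  have hfin : ∀ i, Tendsto (fun n => f i (fun j => T n (w i j)) - f i (fun j => T n (v j)))
      atTop (𝓝 0) := fun i => by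
    have := ((hlim i fun j => ⟨w i j, hwE i j⟩).add (hA i)).sub (hlim i fun j => ⟨v j, hvE j⟩)
    simp only [add_zero, sub_zero] at this
    refine this.congr fun n => ?_
    ring
  have hev : ∀ᶠ n in atTop, ∀ i, |f i (fun j => T n (w i j)) - f i (fun j => T n (v j))| < ε i :=
    eventually_all.2 fun i => by
      simpa [Real.dist_eq] using (Metric.tendsto_nhds.1 (hfin i)) (ε i) (hε i)
  obtain ⟨n, hn⟩ := hev.exists
  exact ⟨T n, hn⟩

end

theorem eventually_forall_abs_smul_sub_lt {G Y : Type*} [Monoid G] [TopologicalSpace G]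
    [TopologicalSpace Y] [CompactSpace Y] [MulAction G Y] [ContinuousSMul G Y] (φ : C(Y, ℝ))
    {ε : ℝ} (hε : 0 < ε) : ∀ᶠ g : G in 𝓝 1, ∀ y, |φ (g • y) - φ y| < ε := by
  have hc : Continuous fun z : G × Y => |φ (z.1 • z.2) - φ z.2| := by fun_prop
  have := isCompact_univ.eventually_forall_of_forall_eventually (x₀ := (1 : G))
    (P := fun (g : G) (y : Y) => |φ (g • y) - φ y| < ε) fun y _ =>
      hc.continuousAt.eventually_lt continuousAt_const (by simpa using hε)
  simpa using this

theorem exists_finset_of_mem_nhds_one {X : Type*} [MetricSpace X] {U : Set (X ≃ᵢ X)}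
    (hU : U ∈ @nhds _ (isoPointwiseTopology X) 1) :
    ∃ (s : Finset X) (δ : ℝ), 0 < δ ∧ ∀ g : X ≃ᵢ X, (∀ x ∈ s, dist (g x) x < δ) → g ∈ U := by
  rw [isoPointwiseTopology, nhds_induced, mem_comap] at hU
  obtain ⟨t, ht, htU⟩ := hU
  rw [nhds_pi, Filter.mem_pi] at ht
  obtain ⟨I, hI, r, hr, hrt⟩ := ht
  have hev : ∀ᶠ δ in 𝓝[>] (0 : ℝ), ∀ x ∈ I, Metric.ball x δ ⊆ r x := by
    refine (eventually_all_finite hI).2 fun x _ => ?_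
    obtain ⟨η, hη, hηr⟩ := Metric.mem_nhds_iff.1 (hr x)
    filter_upwards [Ioo_mem_nhdsGT hη] with δ hδ
    exact (Metric.ball_subset_ball hδ.2.le).trans hηr
  obtain ⟨δ, hδ, hδ0⟩ := (hev.and self_mem_nhdsWithin).exists
  refine ⟨hI.toFinset, δ, hδ0, fun g hg => htU (hrt fun x hx => hδ x hx ?_)⟩
  exact hg x (hI.mem_toFinset.2 hx)

theorem exists_lipschitzWith_abs_comp_sub_le {G Z : Type*} [Nonempty G] [PseudoMetricSpace Z]
    {F : G → ℝ} {p : G → Z} {M δ ε : ℝ} (hM : ∀ S, |F S| ≤ M) (hδ : 0 < δ) (hε : 0 ≤ ε)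
    (hF : ∀ S T, dist (p S) (p T) < δ → |F S - F T| ≤ ε) :
    ∃ (f : Z → ℝ) (K : ℝ≥0), LipschitzWith K f ∧ ∀ S, |f (p S) - F S| ≤ ε := by
  have hM0 : 0 ≤ M := (abs_nonneg _).trans (hM (Classical.arbitrary G))
  let K : ℝ≥0 := ⟨2 * M / δ, by positivity⟩
  have hK : (K : ℝ) = 2 * M / δ := rfl
  have hbdd : ∀ z, BddBelow (Set.range fun T => F T + K * dist z (p T)) := fun z => by
    refine ⟨-M, ?_⟩
    rintro _ ⟨T, rfl⟩
    have := (abs_le.1 (hM T)).1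
    have : 0 ≤ (K : ℝ) * dist z (p T) := by positivity
    simp only
    linarith
  refine ⟨fun z => ⨅ T, (F T + K * dist z (p T)), K, ?_, fun S => ?_⟩
  · refine LipschitzWith.of_le_add_mul K fun x y => ?_
    rw [← sub_le_iff_le_add]
    refine le_ciInf fun T => ?_
    rw [sub_le_iff_le_add]
    refine (ciInf_le (hbdd x) T).trans ?_
    have := mul_le_mul_of_nonneg_left (dist_triangle x y (p T)) K.coe_nonneg
    linarith
  · rw [abs_le]
    constructor
    · rw [le_sub_iff_add_le]
      refine le_ciInf fun T => ?_
      rcases lt_or_ge (dist (p S) (p T)) δ with h | h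
      · have h1 := (abs_le.1 (hF S T h)).2
        have : 0 ≤ (K : ℝ) * dist (p S) (p T) := by positivity
        linarith
      · have h1 : 2 * M ≤ K * dist (p S) (p T) := by
          calc 2 * M = K * δ := by rw [hK]; field_simp
            _ ≤ _ := by gcongr
        have h2 := (abs_le.1 (hM T)).1
        have h3 := (abs_le.1 (hM S)).2
        linarith
    · have h1 := ciInf_le (hbdd (p S)) S
      simp only [dist_self, mul_zero, add_zero] at h1
      linarith

section
variable {H : Type*} [NormedAddCommGroup H] [InnerProductSpace ℝ H]

/-- The isometry of the unit sphere induced by a linear isometry. -/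
def LinearIsometryEquiv.restrictSphere (T : H ≃ₗᵢ[ℝ] H) :
    Metric.sphere (0 : H) 1 ≃ᵢ Metric.sphere (0 : H) 1 where
  toFun x := ⟨T x, by simp⟩
  invFun x := ⟨T.symm x, by simp⟩
  left_inv x := by simp
  right_inv x := by simp
  isometry_toFun x y := T.isometry x y

theorem inner_isometryEquiv_sphere (g : Metric.sphere (0 : H) 1 ≃ᵢ Metric.sphere (0 : H) 1)
    (x y : Metric.sphere (0 : H) 1) : ⟪(g x : H), (g y : H)⟫ = ⟪(x : H), (y : H)⟫ := by
  have h : ‖(g x : H) - g y‖ = ‖(x : H) - y‖ := by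
    simpa [Subtype.dist_eq, dist_eq_norm] using g.dist_eq x y
  rw [real_inner_eq_norm_mul_self_add_norm_mul_self_sub_norm_sub_mul_self_div_two,
    real_inner_eq_norm_mul_self_add_norm_mul_self_sub_norm_sub_mul_self_div_two, h]
  simp

theorem exists_forall_abs_smul_sub_le [CompleteSpace H] (hinf : ¬ FiniteDimensional ℝ H)
    {Y : Type*} [TopologicalSpace Y] [CompactSpace Y] [Nonempty Y]
    [MulAction (Metric.sphere (0 : H) 1 ≃ᵢ Metric.sphere (0 : H) 1) Y]
    (hY : @ContinuousSMul (Metric.sphere (0 : H) 1 ≃ᵢ Metric.sphere (0 : H) 1) Y _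
      (isoPointwiseTopology _) _)
    {ι : Type*} [Finite ι] (g : ι → Metric.sphere (0 : H) 1 ≃ᵢ Metric.sphere (0 : H) 1)
    (φ : ι → C(Y, ℝ)) {ε : ι → ℝ} (hε : ∀ i, 0 < ε i) :
    ∃ y, ∀ i, |φ i (g i • y) - φ i y| ≤ ε i := by
  classical
  have := Fintype.ofFinite ι
  let := isoPointwiseTopology (Metric.sphere (0 : H) 1)
  let y₀ : Y := Classical.arbitrary Y
  have hε' : ∀ i, 0 < ε i / 3 := fun i => by have := hε i; positivity
  choose s δ hδ hs using fun i =>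
    exists_finset_of_mem_nhds_one (eventually_forall_abs_smul_sub_lt
      (G := Metric.sphere (0 : H) 1 ≃ᵢ Metric.sphere (0 : H) 1) (φ i) (hε' i))
  let I := Finset.univ.biUnion s
  let p : (Metric.sphere (0 : H) 1 ≃ᵢ Metric.sphere (0 : H) 1) → I → H := fun S x => S x
  choose f K hfK hf using fun i => exists_lipschitzWith_abs_comp_sub_le
    (F := fun S : Metric.sphere (0 : H) 1 ≃ᵢ Metric.sphere (0 : H) 1 => φ i (S⁻¹ • y₀))
    (p := p) (fun S => (φ i).norm_coe_le_norm (S⁻¹ • y₀)) (hδ i) (hε' i).le fun S T h => by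
      have h1 : T⁻¹ * S ∈ {g | ∀ y, |φ i (g • y) - φ i y| < ε i / 3} := hs i _ fun x hx => by
        have h2 := (dist_pi_lt_iff (hδ i)).1 h ⟨x, Finset.mem_biUnion.2 ⟨i, Finset.mem_univ _, hx⟩⟩
        rw [← T.dist_eq, IsometryEquiv.mul_apply, IsometryEquiv.apply_inv_self]
        exact h2
      have h3 := h1 (S⁻¹ • y₀)
      rw [mul_smul, smul_inv_smul, abs_sub_comm] at h3
      exact h3.le
  obtain ⟨T, hT⟩ := exists_linearIsometryEquiv_abs_sub_lt hinf hfK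
    (v := fun x : I => ((x : Metric.sphere (0 : H) 1) : H)) (w := fun i x => ((g i)⁻¹ x : H))
    (fun i j k => inner_isometryEquiv_sphere _ _ _) hε'
  refine ⟨T.restrictSphere⁻¹ • y₀, fun i => ?_⟩
  have h1 := hf i (T.restrictSphere * (g i)⁻¹)
  have h2 := hf i T.restrictSphere
  have h3 : |f i (p (T.restrictSphere * (g i)⁻¹)) - f i (p T.restrictSphere)| < ε i / 3 := hT i
  simp only [mul_inv_rev, inv_inv, mul_smul] at h1
  rw [abs_le] at h1 h2 ⊢
  rw [abs_lt] at h3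
  constructor <;> linarith [h1.1, h1.2, h2.1, h2.2, h3.1, h3.2]

end

theorem eq_of_forall_continuousMap_eq {Y : Type*} [TopologicalSpace Y] [CompactSpace Y] [T2Space Y]
    {x y : Y} (h : ∀ φ : C(Y, ℝ), φ x = φ y) : x = y := by
  by_contra hxy
  obtain ⟨φ, h0, h1, -⟩ := exists_continuous_zero_one_of_isClosed (isClosed_singleton (x := x))
    (isClosed_singleton (x := y)) (by simpa using hxy)
  have := h φ
  rw [h0 rfl, h1 rfl] at this
  simp at this

end Helpers

/-- The isometry group of the unit sphere of a separable infinite-dimensional real Hilbert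
space, with the topology of pointwise convergence, is extremely amenable. -/
theorem hilbertSphere_isometryGroup_extremelyAmenable
    (H : Type*) [NormedAddCommGroup H] [InnerProductSpace ℝ H] [CompleteSpace H]
    [TopologicalSpace.SeparableSpace H] (hinf : ¬ FiniteDimensional ℝ H) :
    @ExtremelyAmenable (↥(Metric.sphere (0 : H) 1) ≃ᵢ ↥(Metric.sphere (0 : H) 1)) _
      (isoPointwiseTopology ↥(Metric.sphere (0 : H) 1)) := by
  let := isoPointwiseTopology ↥(Metric.sphere (0 : H) 1)
  intro Y _ _ _ _ _ hY
  obtain ⟨y, hy⟩ := CompactSpace.iInter_nonempty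
    (t := fun i : (Metric.sphere (0 : H) 1 ≃ᵢ Metric.sphere (0 : H) 1) × C(Y, ℝ) ×
      {ε : ℝ // 0 < ε} => {y : Y | |i.2.1 (i.1 • y) - i.2.1 y| ≤ i.2.2})
    (fun i => isClosed_le (by fun_prop) continuous_const)
    (fun s => by
      obtain ⟨y, hy⟩ := exists_forall_abs_smul_sub_le hinf hY (fun i : s => i.1.1)
        (fun i => i.1.2.1) (fun i => i.1.2.2.2)
      exact ⟨y, Set.mem_iInter₂.2 fun i hi => hy ⟨i, hi⟩⟩)
  refine ⟨y, fun g => eq_of_forall_continuousMap_eq fun φ => ?_⟩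
  refine eq_of_abs_sub_nonpos (le_of_forall_pos_le_add fun ε hε => ?_)
  simpa using Set.mem_iInter.1 hy (g, φ, ⟨ε, hε⟩)
end

section
/- The group of surjective linear isometries of a separable infinite-dimensional real Hilbert space, endowed with the topology of pointwise convergence (the strong operator topology), is extremely amenable. -/
universe u

/-- The topology of pointwise convergence (strong operator topology) on the group of surjective
linear isometries of a Hilbert space. -/
def linearIsoPointwiseTopology (H : Type*) [NormedAddCommGroup H]
    [InnerProductSpace ℝ H] : TopologicalSpace (H ≃ₗᵢ[ℝ] H) :=
  TopologicalSpace.induced (fun f : H ≃ₗᵢ[ℝ] H => (f : H → H)) Pi.topologicalSpace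

section Concentration

open MeasureTheory

variable {K : Type*} [MeasurableSpace K] (μ : Measure K) [IsProbabilityMeasure μ]

theorem integrable_of_measurable_of_abs_le {X : Type*} [MeasurableSpace X] {ν : Measure X}
    [IsFiniteMeasure ν] {f : X → ℝ} (hf : Measurable f) {C : ℝ} (hC : ∀ x, |f x| ≤ C) :
    Integrable f ν :=
  Integrable.of_bound hf.aestronglyMeasurable C (Filter.Eventually.of_forall hC)

/-- The mean square deviation from an arbitrary centre splits as variance plus squared bias. -/
theorem integral_sub_const_sq {X : Type*} [MeasurableSpace X] {ν : Measure X}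
    [IsProbabilityMeasure ν] {f : X → ℝ} (hf : Measurable f) {C : ℝ} (hC : ∀ x, |f x| ≤ C)
    (m : ℝ) :
    ∫ x, (f x - m) ^ 2 ∂ν
      = ∫ x, (f x - ∫ y, f y ∂ν) ^ 2 ∂ν + ((∫ y, f y ∂ν) - m) ^ 2 := by
  have h1 : Integrable f ν := integrable_of_measurable_of_abs_le hf hC
  have h2 : Integrable (fun x => f x ^ 2) ν :=
    integrable_of_measurable_of_abs_le (hf.pow_const 2) (C := C ^ 2) fun x => by
      rw [abs_pow]; exact pow_le_pow_left₀ (abs_nonneg _) (hC x) 2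
  have key : ∀ a : ℝ, ∫ x, (f x - a) ^ 2 ∂ν
      = ∫ x, f x ^ 2 ∂ν - 2 * a * ∫ x, f x ∂ν + a ^ 2 := by
    intro a
    have : (fun x => (f x - a) ^ 2) = fun x => (f x ^ 2 - 2 * a * f x) + a ^ 2 := by
      ext x; ring
    have h3 : Integrable (fun x => f x ^ 2 - 2 * a * f x) ν := h2.sub (h1.const_mul _)
    rw [this, integral_add h3 (integrable_const _), integral_sub h2 (h1.const_mul _),
      integral_const_mul]
    simp
  rw [key, key]; ring

/-- A function on a finite power of a probability space whose value changes by at most `c` when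
a single coordinate is changed has variance at most `n * c ^ 2`. -/
theorem integral_sub_integral_sq_le (n : ℕ) (f : (Fin n → K) → ℝ) (hf : Measurable f) {C c : ℝ}
    (hC : ∀ u, |f u| ≤ C) (hc : ∀ u i a, |f (Function.update u i a) - f u| ≤ c) :
    ∫ u, (f u - ∫ v, f v ∂Measure.pi fun _ => μ) ^ 2 ∂Measure.pi (fun _ : Fin n => μ)
      ≤ n * c ^ 2 := by
  induction n with
  | zero =>
    have : ∀ u, f u = f default := fun u => congrArg f (Subsingleton.elim _ _)
    simp [this]
  | succ n ih =>
    let e := (MeasurableEquiv.piFinSuccAbove (fun _ : Fin (n + 1) => K) 0).symm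
    have he : MeasurePreserving e (μ.prod (Measure.pi fun _ : Fin n => μ))
        (Measure.pi fun _ : Fin (n + 1) => μ) :=
      (measurePreserving_piFinSuccAbove (fun _ : Fin (n + 1) => μ) 0).symm
    have hee : ∀ a u, e (a, u) = Fin.cons a u := fun a u => by
      simp [e, MeasurableEquiv.piFinSuccAbove, Fin.insertNthEquiv]
    let F : K × (Fin n → K) → ℝ := fun p => f (e p)
    have hF : Measurable F := hf.comp e.measurable
    have hFC : ∀ p, |F p| ≤ C := fun p => hC _
    let g : K → ℝ := fun a => ∫ u, F (a, u) ∂Measure.pi fun _ : Fin n => μ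
    have hg : Measurable g := (hF.stronglyMeasurable.integral_prod_right').measurable
    have hgC : ∀ a, |g a| ≤ C := fun a => by
      have := norm_integral_le_of_norm_le_const (μ := Measure.pi fun _ : Fin n => μ)
        (f := fun u => F (a, u)) (Filter.Eventually.of_forall fun u => hFC (a, u))
      simpa using this
    have hFa : ∀ a, Measurable fun u => F (a, u) := fun a => hF.comp measurable_prodMk_left
    have hmean : ∫ v, f v ∂Measure.pi (fun _ : Fin (n + 1) => μ) = ∫ a, g a ∂μ := by
      rw [← he.integral_comp' f,
        integral_prod _ (integrable_of_measurable_of_abs_le hF hFC)]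
    set m := ∫ a, g a ∂μ with hm
    have hgg : ∀ a b, |g a - g b| ≤ c := fun a b => by
      rw [← integral_sub (integrable_of_measurable_of_abs_le (hFa a) fun u => hFC _)
        (integrable_of_measurable_of_abs_le (hFa b) fun u => hFC _)]
      have := norm_integral_le_of_norm_le_const (μ := Measure.pi fun _ : Fin n => μ)
        (f := fun u => F (a, u) - F (b, u)) (C := c) (Filter.Eventually.of_forall fun u => by
          have := hc (Fin.cons b u) 0 a
          rw [Fin.update_cons_zero] at this
          simpa [F, hee] using this)
      simpa using this
    have hgm : ∀ a, (g a - m) ^ 2 ≤ c ^ 2 := fun a => by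
      have h1 : g a - m = ∫ b, (g a - g b) ∂μ := by
        rw [integral_sub (integrable_const _) (integrable_of_measurable_of_abs_le hg hgC)]
        simp [hm]
      have h2 := norm_integral_le_of_norm_le_const (μ := μ)
        (f := fun b => g a - g b) (C := c) (Filter.Eventually.of_forall fun b => hgg a b)
      rw [← h1] at h2
      have h3 : |g a - m| ≤ c := by simpa using h2
      exact sq_le_sq' (abs_le.1 h3).1 (abs_le.1 h3).2
    have hsqC : ∀ p, |(F p - m) ^ 2| ≤ (C + |m|) ^ 2 := fun p => by
      rw [abs_pow]
      exact pow_le_pow_left₀ (abs_nonneg _)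
        ((abs_sub _ _).trans (add_le_add_left (hFC p) _)) 2
    have hsq : Integrable (fun p => (F p - m) ^ 2)
        (μ.prod (Measure.pi fun _ : Fin n => μ)) :=
      integrable_of_measurable_of_abs_le ((hF.sub_const m).pow_const 2) hsqC
    rw [hmean, ← he.integral_comp' (fun u => (f u - m) ^ 2), integral_prod _ hsq]
    have hinner : ∀ a, ∫ u, (F (a, u) - m) ^ 2 ∂Measure.pi (fun _ : Fin n => μ)
        ≤ (n + 1) * c ^ 2 := fun a => by
      rw [integral_sub_const_sq (hFa a) (fun u => hFC (a, u))]
      have := ih (fun u => F (a, u)) (hFa a) (fun u => hFC _) fun u i b => by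
        have := hc (Fin.cons a u) i.succ b
        rw [← Fin.cons_update] at this
        simpa [F, hee] using this
      have := hgm a
      simp only [g] at this
      linarith
    calc _ ≤ ∫ _ : K, ((n : ℝ) + 1) * c ^ 2 ∂μ :=
          integral_mono hsq.integral_prod_left (integrable_const _) hinner
      _ = _ := by simp

end Concentration

section UniformConcentration

open MeasureTheory

/-- A function that is Lipschitz up to an additive error is uniformly close to a Lipschitz one. -/
theorem exists_lipschitz_approx {X : Type*} (D : X → X → ℝ) (hD0 : ∀ x, D x x = 0)
    (hDsymm : ∀ x y, D x y = D y x) (hDtri : ∀ x y z, D x z ≤ D x y + D y z)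
    (f : X → ℝ) {L η : ℝ} (hL : 0 ≤ L) (hf : ∀ x y, |f x - f y| ≤ η + L * D x y) :
    ∃ g : X → ℝ, (∀ x y, |g x - g y| ≤ L * D x y) ∧ ∀ x, |f x - g x| ≤ η := by
  have hbdd : ∀ x, BddBelow (Set.range fun y => f y + L * D x y) := fun x =>
    ⟨f x - η, by rintro _ ⟨y, rfl⟩; have := (abs_le.1 (hf x y)).2; dsimp only; linarith⟩
  have hle : ∀ x y, (⨅ z, f z + L * D x z) ≤ (⨅ z, f z + L * D y z) + L * D x y := fun x y => by
    have : Nonempty X := ⟨x⟩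
    rw [← sub_le_iff_le_add]
    refine le_ciInf fun z => ?_
    have h1 := ciInf_le (hbdd x) z
    have h2 := mul_le_mul_of_nonneg_left (hDtri x y z) hL
    linarith
  refine ⟨fun x => ⨅ z, f z + L * D x z, fun x y => ?_, fun x => ?_⟩
  · have h1 := hle x y
    have h2 := hle y x
    rw [hDsymm y x] at h2
    exact abs_le.2 ⟨by linarith, by linarith⟩
  · have : Nonempty X := ⟨x⟩
    have h1 := ciInf_le (hbdd x) x
    have h2 : f x - η ≤ ⨅ z, f z + L * D x z := le_ciInf fun y => by
      have := (abs_le.1 (hf x y)).2; linarith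
    have h3 := hf x x
    rw [sub_self, abs_zero, hD0, mul_zero, add_zero] at h3
    simp only [hD0, mul_zero, add_zero] at h1
    exact abs_le.2 ⟨by linarith, by linarith⟩

/-- Concentration of measure on powers of a compact group: finitely many functions that are
uniformly continuous for the normalised `ℓ¹` distance are simultaneously almost invariant, at some
point, under prescribed diagonal translations. -/
theorem exists_forall_abs_translate_sub_le {K : Type*} [MetricSpace K] [CompactSpace K] [Group K]
    [IsTopologicalGroup K] {ι : Type*} [Fintype ι] {n : ℕ} (hn : 0 < n)
    (f : ι → (Fin n → K) → ℝ) (k : ι → K) {L η ε R : ℝ} (hL : 0 ≤ L) (hε : 0 ≤ ε)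
    (hR : ∀ x y : K, dist x y ≤ R)
    (hf : ∀ i u v, |f i u - f i v| ≤ η + L * ((∑ j, dist (u j) (v j)) / n))
    (hcard : Fintype.card ι * (4 * (L * R) ^ 2 / n) ≤ ε ^ 2) :
    ∃ u : Fin n → K, ∀ i, |f i (fun j => k i * u j) - f i u| ≤ 2 * η + ε := by
  borelize K
  have hn' : (0 : ℝ) < n := by exact_mod_cast hn
  let μ : Measure K := Measure.haarMeasure ⊤
  have : IsProbabilityMeasure μ := ⟨Measure.haarMeasure_self⟩
  let ν := Measure.pi fun _ : Fin n => μ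
  let D : (Fin n → K) → (Fin n → K) → ℝ := fun u v => (∑ j, dist (u j) (v j)) / n
  have happrox := fun i => exists_lipschitz_approx D (by simp [D])
    (fun u v => by simp only [D, dist_comm])
    (fun u v w => by
      simp only [D]
      rw [← add_div, ← Finset.sum_add_distrib]
      gcongr
      exact dist_triangle _ _ _) (f i) hL (hf i)
  choose g hg hfg using happrox
  have hDcont : ∀ v, Continuous fun u => D u v := fun v => by fun_prop
  have hgcont : ∀ i, Continuous (g i) := fun i => by
    refine continuous_iff_continuousAt.2 fun v => tendsto_iff_dist_tendsto_zero.2 ?_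
    refine squeeze_zero (fun _ => dist_nonneg) (fun u => hg i u v) ?_
    have : Filter.Tendsto (fun u => L * D u v) (nhds v) (nhds (L * D v v)) :=
      (continuous_const.mul (hDcont v)).tendsto v
    simpa [D] using this
  have hgmeas : ∀ i, Measurable (g i) := fun i => (hgcont i).measurable
  have hgbdd : ∀ i, ∃ C, ∀ u, |g i u| ≤ C := fun i => by
    obtain ⟨C, hC⟩ := isCompact_univ.exists_bound_of_continuousOn (hgcont i).continuousOn
    exact ⟨C, fun u => hC u trivial⟩
  choose C hC using hgbdd
  let m : ι → ℝ := fun i => ∫ u, g i u ∂ν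
  have hvar : ∀ i, ∫ u, (g i u - m i) ^ 2 ∂ν ≤ (L * R) ^ 2 / n := fun i => by
    refine (integral_sub_integral_sq_le μ n (g i) (hgmeas i) (C := C i) (c := L * R / n) (hC i)
      fun u j a => (hg i _ _).trans ?_).trans_eq (by field_simp)
    have : D (Function.update u j a) u ≤ R / n := by
      simp only [D]
      gcongr
      rw [Finset.sum_eq_single j]
      · exact hR _ _
      · intro b _ hb; simp [hb]
      · simp
    calc L * D (Function.update u j a) u ≤ L * (R / n) := by gcongr
      _ = _ := by ring
  have hint : ∀ {h : (Fin n → K) → ℝ}, Continuous h → Integrable h ν := fun {h} hh => by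
    obtain ⟨C, hC⟩ := isCompact_univ.exists_bound_of_continuousOn hh.continuousOn
    exact integrable_of_measurable_of_abs_le hh.measurable fun u => hC u trivial
  have htrans : ∀ i, ∫ u, (g i ((fun _ => k i) * u) - m i) ^ 2 ∂ν
      = ∫ u, (g i u - m i) ^ 2 ∂ν := fun i =>
    integral_mul_left_eq_self (μ := ν) (fun u => (g i u - m i) ^ 2) (fun _ => k i)
  let S : (Fin n → K) → ℝ := fun u => ∑ i, (g i ((fun _ => k i) * u) - g i u) ^ 2
  have hSc : ∀ i, Continuous fun u : Fin n → K => g i ((fun _ => k i) * u) := fun i =>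
    (hgcont i).comp (continuous_const.mul continuous_id)
  have hI : ∀ i, Integrable (fun u => (g i ((fun _ => k i) * u) - g i u) ^ 2) ν := fun i =>
    hint (((hSc i).sub (hgcont i)).pow 2)
  have hS : ∫ u, S u ∂ν ≤ ε ^ 2 := by
    refine le_trans ?_ hcard
    simp only [S]
    rw [integral_finsetSum _ fun i _ => hI i]
    rw [← nsmul_eq_mul, ← Finset.card_univ]
    refine Finset.sum_le_card_nsmul _ _ _ fun i _ => ?_
    have h1 : Integrable (fun u => 2 * (g i ((fun _ => k i) * u) - m i) ^ 2) ν :=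
      (hint (((hSc i).sub continuous_const).pow 2)).const_mul 2
    have h2 : Integrable (fun u => 2 * (g i u - m i) ^ 2) ν :=
      (hint (((hgcont i).sub continuous_const).pow 2)).const_mul 2
    calc ∫ u, (g i ((fun _ => k i) * u) - g i u) ^ 2 ∂ν
        ≤ ∫ u, (2 * (g i ((fun _ => k i) * u) - m i) ^ 2 + 2 * (g i u - m i) ^ 2) ∂ν :=
          integral_mono (hI i) (h1.add h2) fun u => by
            dsimp only
            nlinarith [sq_nonneg ((g i ((fun _ => k i) * u) - m i) + (g i u - m i))]
      _ ≤ 4 * (L * R) ^ 2 / n := by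
          rw [integral_add h1 h2, integral_const_mul, integral_const_mul, htrans i]
          have := hvar i
          rw [mul_div_assoc]
          linarith
  obtain ⟨u, hu⟩ := exists_le_integral (integrable_finsetSum _ fun i _ => hI i)
  refine ⟨u, fun i => ?_⟩
  have h1 : (g i ((fun _ => k i) * u) - g i u) ^ 2 ≤ ε ^ 2 :=
    (Finset.single_le_sum (f := fun i => (g i ((fun _ => k i) * u) - g i u) ^ 2)
      (fun _ _ => sq_nonneg _) (Finset.mem_univ i)).trans (hu.trans hS)
  have h2 := abs_le.1 (abs_le_of_sq_le_sq h1 hε)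
  have h3 := abs_le.1 (hfg i u)
  have h4 := abs_le.1 (hfg i ((fun _ => k i) * u))
  change |f i ((fun _ => k i) * u) - f i u| ≤ _
  exact abs_le.2 ⟨by linarith, by linarith⟩

end UniformConcentration

section Geometry

open Module

variable {H : Type*} [NormedAddCommGroup H] [InnerProductSpace ℝ H]

instance compactSpace_unitary {W : Type*} [NormedAddCommGroup W] [InnerProductSpace ℝ W]
    [FiniteDimensional ℝ W] : CompactSpace (unitary (W →L[ℝ] W)) := by
  have : ProperSpace (W →L[ℝ] W) := FiniteDimensional.proper ℝ _
  refine isCompact_iff_compactSpace.1 (Metric.isCompact_of_isClosed_isBounded isClosed_unitary ?_)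
  refine (Metric.isBounded_closedBall (x := (0 : W →L[ℝ] W)) (r := 1)).subset fun u hu => ?_
  rw [mem_closedBall_zero_iff]
  refine ContinuousLinearMap.opNorm_le_bound _ zero_le_one fun x => ?_
  rw [u.norm_map_of_mem_unitary hu, one_mul]

instance isTopologicalGroup_unitary {W : Type*} [NormedAddCommGroup W] [InnerProductSpace ℝ W]
    [CompleteSpace W] : IsTopologicalGroup (unitary (W →L[ℝ] W)) :=
  inferInstance

theorem exists_linearIsometry_of_not_finiteDimensional (hinf : ¬ FiniteDimensional ℝ H)
    (Z : Type*) [NormedAddCommGroup Z] [InnerProductSpace ℝ Z] [FiniteDimensional ℝ Z] :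
    Nonempty (Z →ₗᵢ[ℝ] H) := by
  have hrank : Cardinal.aleph0 ≤ Module.rank ℝ H := by
    rwa [← not_lt, Module.rank_lt_aleph0_iff]
  obtain ⟨v, hv⟩ := exists_linearIndependent_of_le_rank (R := ℝ) (M := H) (n := finrank ℝ Z)
    ((Cardinal.natCast_lt_aleph0).le.trans hrank)
  let S := Submodule.span ℝ (Set.range v)
  have hS : finrank ℝ S = finrank ℝ Z := by
    rw [finrank_span_eq_card hv, Fintype.card_fin]
  have : FiniteDimensional ℝ S := FiniteDimensional.span_of_finite ℝ (Set.finite_range v)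
  exact ⟨S.subtypeₗᵢ.comp ((stdOrthonormalBasis ℝ Z).equiv (stdOrthonormalBasis ℝ S)
    (finCongr hS.symm)).toLinearIsometry⟩

/-- A finite-dimensional extension of a finite-dimensional subspace of an infinite-dimensional
inner product space embeds over that subspace. -/
theorem exists_linearIsometry_extending_subtype (hinf : ¬ FiniteDimensional ℝ H)
    (W : Submodule ℝ H) [FiniteDimensional ℝ W]
    {Z : Type*} [NormedAddCommGroup Z] [InnerProductSpace ℝ Z] [FiniteDimensional ℝ Z]
    (D : W →ₗᵢ[ℝ] Z) : ∃ J : Z →ₗᵢ[ℝ] H, ∀ w, J (D w) = w := by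
  obtain ⟨J₀⟩ := exists_linearIsometry_of_not_finiteDimensional hinf Z
  let V : Submodule ℝ H := W ⊔ LinearMap.range J₀.toLinearMap
  let J₁ : Z →ₗᵢ[ℝ] V :=
    { J₀.toLinearMap.codRestrict V fun z =>
        (le_sup_right : _ ≤ V) (LinearMap.mem_range_self J₀.toLinearMap z) with
      norm_map' := fun z => J₀.norm_map z }
  let ι : W →ₗᵢ[ℝ] V :=
    { Submodule.inclusion (le_sup_left : W ≤ V) with norm_map' := fun _ => rfl }
  let A : W →ₗᵢ[ℝ] V := J₁.comp D
  let L : LinearMap.range A.toLinearMap →ₗᵢ[ℝ] V := ι.comp A.equivRange.symm.toLinearIsometry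
  refine ⟨(V.subtypeₗᵢ.comp L.extend).comp J₁, fun w => ?_⟩
  have h1 : J₁ (D w) = ((A.equivRange w : LinearMap.range A.toLinearMap) : V) := rfl
  have h2 : L.extend (J₁ (D w)) = ι w := by
    rw [h1, L.extend_apply]
    simp [L]
  change ((L.extend (J₁ (D w)) : V) : H) = w
  rw [h2]
  rfl

section Extend

variable [CompleteSpace H] {Z : Type*} [NormedAddCommGroup Z] [InnerProductSpace ℝ Z]
  [CompleteSpace Z]

open ContinuousLinearMap

theorem adjoint_linearIsometry_apply (J : Z →ₗᵢ[ℝ] H) (z : Z) :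
    adjoint J.toContinuousLinearMap (J z) = z := by
  refine ext_inner_right ℝ fun y => ?_
  rw [adjoint_inner_left]
  exact J.inner_map_map z y

theorem norm_add_extend_sq (J : Z →ₗᵢ[ℝ] H) (e : Z ≃ₗᵢ[ℝ] Z) (x : H) :
    ‖x + J (e (adjoint J.toContinuousLinearMap x) - adjoint J.toContinuousLinearMap x)‖ = ‖x‖ := by
  set y := adjoint J.toContinuousLinearMap x with hy
  have h1 : inner ℝ x (J (e y - y)) = inner ℝ y (e y - y) := by
    rw [hy, adjoint_inner_left]; rfl
  rw [← sq_eq_sq₀ (norm_nonneg _) (norm_nonneg _), norm_add_sq_real, h1, J.norm_map,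
    norm_sub_sq_real, inner_sub_right, e.norm_map, real_inner_self_eq_norm_sq,
    real_inner_comm (e y) y]
  ring

/-- An isometric embedding `J : Z → H` lets the isometry group of `Z` act on `H`, trivially on the
orthogonal complement of the range. -/
noncomputable def extendIsometry (J : Z →ₗᵢ[ℝ] H) : (Z ≃ₗᵢ[ℝ] Z) →* (H ≃ₗᵢ[ℝ] H) :=
  let P : (Z ≃ₗᵢ[ℝ] Z) → H →ₗ[ℝ] H := fun e =>
    LinearMap.id + J.toLinearMap ∘ₗ (e.toLinearEquiv.toLinearMap - LinearMap.id) ∘ₗ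
      (adjoint J.toContinuousLinearMap).toLinearMap
  have hP : ∀ e x, P e x = x + J (e (adjoint J.toContinuousLinearMap x)
      - adjoint J.toContinuousLinearMap x) := fun _ _ => rfl
  have hmul : ∀ e e' x, P (e * e') x = P e (P e' x) := fun e e' x => by
    simp only [hP, map_add, map_sub, adjoint_linearIsometry_apply, LinearIsometryEquiv.coe_mul,
      Function.comp_apply]
    abel
  have hone : ∀ x, P 1 x = x := fun x => by simp [hP]
  { toFun := fun e =>
      { P e with
        invFun := P e⁻¹
        left_inv := fun x => by
          change P e⁻¹ (P e x) = x
          rw [← hmul, inv_mul_cancel, hone]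
        right_inv := fun x => by
          change P e (P e⁻¹ x) = x
          rw [← hmul, mul_inv_cancel, hone]
        norm_map' := fun x => norm_add_extend_sq J e x }
    map_one' := LinearIsometryEquiv.ext hone
    map_mul' := fun e e' => LinearIsometryEquiv.ext (hmul e e') }

theorem extendIsometry_apply_map (J : Z →ₗᵢ[ℝ] H) (e : Z ≃ₗᵢ[ℝ] Z) (z : Z) :
    extendIsometry J e (J z) = J (e z) := by
  change J z + J (e (adjoint J.toContinuousLinearMap (J z))
      - adjoint J.toContinuousLinearMap (J z)) = _
  rw [adjoint_linearIsometry_apply, map_sub]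
  abel

end Extend

/-- Coordinatewise action of a power of an isometry group on the `ℓ²` direct sum. -/
noncomputable def piLpIsometry (W : Type*) [NormedAddCommGroup W] [InnerProductSpace ℝ W]
    [CompleteSpace W] (n : ℕ) :
    (Fin n → unitary (W →L[ℝ] W)) →* (PiLp 2 (fun _ : Fin n => W) ≃ₗᵢ[ℝ]
      PiLp 2 (fun _ : Fin n => W)) where
  toFun u := LinearIsometryEquiv.piLpCongrRight 2 fun i => Unitary.linearIsometryEquiv (u i)
  map_one' := by ext; simp
  map_mul' u v := by ext; simp

theorem piLpIsometry_apply {W : Type*} [NormedAddCommGroup W] [InnerProductSpace ℝ W]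
    [CompleteSpace W] {n : ℕ} (u : Fin n → unitary (W →L[ℝ] W)) (z : PiLp 2 fun _ : Fin n => W)
    (i : Fin n) : piLpIsometry W n u z i = (u i : W →L[ℝ] W) (z i) := rfl

/-- The normalised diagonal embedding into an `ℓ²` direct sum of copies. -/
noncomputable def diagIsometry (W : Type*) [NormedAddCommGroup W] [InnerProductSpace ℝ W]
    {n : ℕ} (hn : 0 < n) : W →ₗᵢ[ℝ] PiLp 2 (fun _ : Fin n => W) where
  toFun w := WithLp.toLp 2 fun _ => (√n)⁻¹ • w
  map_add' x y := by ext; simp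
  map_smul' c x := by ext; simp [smul_comm c]
  norm_map' w := by
    have hn' : (0 : ℝ) < n := by exact_mod_cast hn
    rw [← sq_eq_sq₀ (norm_nonneg _) (norm_nonneg _), PiLp.norm_sq_eq_of_L2]
    simp [norm_smul, mul_pow]
    field_simp

theorem dist_unitary_le_two {W : Type*} [NormedAddCommGroup W] [InnerProductSpace ℝ W]
    [CompleteSpace W] (u v : unitary (W →L[ℝ] W)) : dist u v ≤ 2 := by
  rw [Subtype.dist_eq, dist_eq_norm]
  refine ContinuousLinearMap.opNorm_le_bound _ zero_le_two fun x => ?_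
  calc ‖(u : W →L[ℝ] W) x - (v : W →L[ℝ] W) x‖
      ≤ ‖(u : W →L[ℝ] W) x‖ + ‖(v : W →L[ℝ] W) x‖ := norm_sub_le _ _
    _ = 2 * ‖x‖ := by rw [Unitary.norm_map, Unitary.norm_map]; ring

theorem norm_mul_inv_sub_one_eq_dist {W : Type*} [NormedAddCommGroup W] [InnerProductSpace ℝ W]
    [CompleteSpace W] (u v : unitary (W →L[ℝ] W)) :
    ‖((u * v⁻¹ : unitary (W →L[ℝ] W)) : W →L[ℝ] W) - 1‖ = dist u v := by
  rw [Subtype.dist_eq, dist_eq_norm, ← CStarRing.norm_mul_coe_unitary ((u : W →L[ℝ] W) - v) v⁻¹]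
  congr 1
  have : (v : W →L[ℝ] W) * (v⁻¹ : unitary (W →L[ℝ] W)) = 1 := by
    rw [← Submonoid.coe_mul, mul_inv_cancel, Submonoid.coe_one]
  rw [sub_mul, this]
  rfl

/-- For every `n > 0` the `n`-th power of the orthogonal group of a finite-dimensional subspace `W`
acts on the whole space so that the diagonal acts on `W` in the standard way and elements near `1`
in normalised `ℓ¹` distance nearly fix the vectors of `W`. -/
theorem exists_pi_unitary_hom [CompleteSpace H] (hinf : ¬ FiniteDimensional ℝ H)
    (W : Submodule ℝ H) [FiniteDimensional ℝ W] {n : ℕ} (hn : 0 < n) :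
    ∃ ρ : (Fin n → unitary (W →L[ℝ] W)) →* (H ≃ₗᵢ[ℝ] H),
      (∀ (k : unitary (W →L[ℝ] W)) (w : W), ρ (fun _ => k) w = (k : W →L[ℝ] W) w) ∧
      ∀ (u v : Fin n → unitary (W →L[ℝ] W)) (w : W),
        ‖ρ (u * v⁻¹) w - w‖ ^ 2 ≤ 2 * ((∑ i, dist (u i) (v i)) / n) * ‖w‖ ^ 2 := by
  have hn' : (0 : ℝ) < n := by exact_mod_cast hn
  obtain ⟨J, hJ⟩ := exists_linearIsometry_extending_subtype hinf W (diagIsometry W hn)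
  have key : ∀ (u : Fin n → unitary (W →L[ℝ] W)) (w : W),
      extendIsometry J (piLpIsometry W n u) w = J (piLpIsometry W n u (diagIsometry W hn w)) :=
    fun u w => by rw [← hJ w, extendIsometry_apply_map]
  refine ⟨(extendIsometry J).comp (piLpIsometry W n), fun k w => ?_, fun u v w => ?_⟩
  · rw [MonoidHom.comp_apply, key, ← hJ ((k : W →L[ℝ] W) w)]
    congr 1
    ext i
    simp [piLpIsometry_apply, diagIsometry]
  · rw [MonoidHom.comp_apply, key, ← hJ w, ← map_sub, J.norm_map, PiLp.norm_sq_eq_of_L2]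
    have hterm : ∀ i, ‖(piLpIsometry W n (u * v⁻¹) (diagIsometry W hn w) - diagIsometry W hn w) i‖
        ^ 2 ≤ 2 * (dist (u i) (v i) / n) * ‖w‖ ^ 2 := fun i => by
      have h0 : (piLpIsometry W n (u * v⁻¹) (diagIsometry W hn w) - diagIsometry W hn w) i
          = (√n)⁻¹ • (((u * v⁻¹) i : W →L[ℝ] W) - 1) w := by
        rw [PiLp.sub_apply, piLpIsometry_apply]
        simp only [diagIsometry, LinearIsometry.coe_mk, LinearMap.coe_mk, AddHom.coe_mk, map_smul,
          sub_apply, one_apply_eq_self, smul_sub]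
      have h1 : ‖(((u * v⁻¹) i : unitary (W →L[ℝ] W)) : W →L[ℝ] W) - 1‖ = dist (u i) (v i) :=
        norm_mul_inv_sub_one_eq_dist (u i) (v i)
      have h2 := ContinuousLinearMap.le_opNorm
        ((((u * v⁻¹) i : unitary (W →L[ℝ] W)) : W →L[ℝ] W) - 1) w
      rw [h1] at h2
      rw [h0, norm_smul, mul_pow]
      have h3 : ‖(√(n : ℝ))⁻¹‖ ^ 2 = (n : ℝ)⁻¹ := by
        rw [norm_inv, inv_pow, Real.norm_eq_abs, sq_abs, Real.sq_sqrt hn'.le]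
      have h4 : dist (u i) (v i) ^ 2 ≤ 2 * dist (u i) (v i) := by
        rw [sq]; exact mul_le_mul_of_nonneg_right (dist_unitary_le_two _ _) dist_nonneg
      rw [h3]
      calc (n : ℝ)⁻¹ * ‖((((u * v⁻¹) i : unitary (W →L[ℝ] W)) : W →L[ℝ] W) - 1) w‖ ^ 2
          ≤ (n : ℝ)⁻¹ * (dist (u i) (v i) * ‖w‖) ^ 2 := by gcongr
        _ = (n : ℝ)⁻¹ * (dist (u i) (v i) ^ 2 * ‖w‖ ^ 2) := by ring
        _ ≤ (n : ℝ)⁻¹ * (2 * dist (u i) (v i) * ‖w‖ ^ 2) := by gcongr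
        _ = _ := by ring
    refine (Finset.sum_le_sum fun i _ => hterm i).trans_eq ?_
    rw [← Finset.sum_mul, ← Finset.mul_sum, ← Finset.sum_div]

end Geometry

section FixedPoint

open Filter Topology

/-- A continuous function on a compact space is moved uniformly little by group elements
near `1`. -/
theorem eventually_nhds_one_forall_abs_sub_lt {G Y : Type*} [Monoid G] [TopologicalSpace G]
    [TopologicalSpace Y] [CompactSpace Y] [MulAction G Y] [ContinuousSMul G Y] (φ : C(Y, ℝ))
    {ε : ℝ} (hε : 0 < ε) : ∀ᶠ h in 𝓝 (1 : G), ∀ y : Y, |φ (h • y) - φ y| < ε := by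
  have hc : Continuous fun p : G × Y => |φ (p.1 • p.2) - φ p.2| := by fun_prop
  have := (isCompact_univ (X := Y)).eventually_forall_of_forall_eventually (x₀ := (1 : G))
    (P := fun h y => |φ (h • y) - φ y| < ε) fun y _ =>
      (hc.tendsto (1, y)).eventually (gt_mem_nhds (by simpa using hε))
  simpa using this

/-- Fixed points exist as soon as finitely many continuous functions at a time can be made almost
invariant at some point. -/
theorem exists_fixedPoint_of_finite_almost_invariant {G Y : Type*} [Group G] [TopologicalSpace Y]
    [CompactSpace Y] [T2Space Y] [MulAction G Y] [ContinuousConstSMul G Y]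
    (h : ∀ s : Finset (C(Y, ℝ) × G), ∃ y : Y, ∀ p ∈ s, |p.1 (p.2 • y) - p.1 y| ≤ 1) :
    ∃ y : Y, ∀ g : G, g • y = y := by
  obtain ⟨y, -, hy⟩ := (isCompact_univ (X := Y)).inter_iInter_nonempty
    (fun p : C(Y, ℝ) × G => {y | |p.1 (p.2 • y) - p.1 y| ≤ 1})
    (fun p => isClosed_le
      (((p.1.continuous.comp (continuous_const_smul p.2)).sub p.1.continuous).abs)
      continuous_const)
    (fun s => by
      obtain ⟨y, hy⟩ := h s
      exact ⟨y, trivial, by simpa using hy⟩)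
  refine ⟨y, fun g => by_contra fun hne => ?_⟩
  obtain ⟨φ, h0, h1, -⟩ := exists_continuous_zero_one_of_isClosed (isClosed_singleton (x := y))
    (isClosed_singleton (x := g • y)) (by simpa using Ne.symm hne)
  have h2 := Set.mem_iInter.1 hy ((2 : ℝ) • φ, g)
  have h3 : φ y = 0 := h0 rfl
  have h4 : φ (g • y) = 1 := h1 rfl
  norm_num [h3, h4] at h2

variable {H : Type*} [NormedAddCommGroup H] [InnerProductSpace ℝ H]

theorem exists_finset_of_mem_nhds_one_s10 {V : Set (H ≃ₗᵢ[ℝ] H)}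
    (hV : V ∈ @nhds _ (linearIsoPointwiseTopology H) 1) :
    ∃ (S : Finset H) (δ : ℝ), 0 < δ ∧
      ∀ h : H ≃ₗᵢ[ℝ] H, (∀ e ∈ S, ‖h e - e‖ < δ) → h ∈ V := by
  obtain ⟨U, hU, hUV⟩ := (@mem_nhds_induced _ _ _ (fun f : H ≃ₗᵢ[ℝ] H => (f : H → H)) 1 V).1 hV
  rw [nhds_pi, Filter.mem_pi'] at hU
  obtain ⟨S, t, ht, htU⟩ := hU
  have hδ : ∀ᶠ δ in 𝓝[>] (0 : ℝ), ∀ e ∈ S, Metric.ball e δ ⊆ t e := by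
    refine (Filter.eventually_all_finset S).2 fun e _ => ?_
    obtain ⟨r, hr, hrt⟩ := Metric.mem_nhds_iff.1 (ht e)
    filter_upwards [Ioo_mem_nhdsGT hr] with δ hδ
    exact (Metric.ball_subset_ball hδ.2.le).trans hrt
  obtain ⟨δ, hδ, hδ0⟩ := (hδ.and self_mem_nhdsWithin).exists
  exact ⟨S, δ, hδ0, fun h hh => hUV (htU fun e he =>
    hδ e he (by rw [Metric.mem_ball, dist_eq_norm]; exact hh e he))⟩

/-- On a finite-dimensional subspace `W`, an isometry agrees with some isometry of `W` wherever it
does not leave `W`. -/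
theorem exists_unitary_eq_on (W : Submodule ℝ H) [FiniteDimensional ℝ W] (g : H ≃ₗᵢ[ℝ] H) :
    ∃ k : unitary (W →L[ℝ] W), ∀ w : W, g w ∈ W → ((k : W →L[ℝ] W) w : H) = g w := by
  let T : Submodule ℝ W := W.comap (g.toLinearEquiv.toLinearMap ∘ₗ W.subtype)
  let L : T →ₗᵢ[ℝ] W :=
    { (g.toLinearEquiv.toLinearMap ∘ₗ W.subtype ∘ₗ T.subtype).codRestrict W fun x => x.2 with
      norm_map' := fun x => g.norm_map x }
  refine ⟨Unitary.linearIsometryEquiv.symm (L.extend.toLinearIsometryEquiv rfl), fun w hw => ?_⟩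
  exact congrArg Subtype.val (L.extend_apply ⟨w, hw⟩)

theorem exists_almost_invariant_point [CompleteSpace H] (hinf : ¬ FiniteDimensional ℝ H)
    {Y : Type*} [TopologicalSpace Y] [CompactSpace Y] [Nonempty Y] [MulAction (H ≃ₗᵢ[ℝ] H) Y]
    (hY : @ContinuousSMul (H ≃ₗᵢ[ℝ] H) Y _ (linearIsoPointwiseTopology H) _)
    (s : Finset (C(Y, ℝ) × (H ≃ₗᵢ[ℝ] H))) :
    ∃ y : Y, ∀ p ∈ s, |p.1 (p.2 • y) - p.1 y| ≤ 1 := by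
  let _ := linearIsoPointwiseTopology H
  obtain ⟨S, δ, hδ, hS⟩ := exists_finset_of_mem_nhds_one_s10
    ((Filter.eventually_all_finset s).2 fun p _ =>
      eventually_nhds_one_forall_abs_sub_lt (G := H ≃ₗᵢ[ℝ] H) p.1 (ε := 1 / 4) (by norm_num))
  simp only [Set.mem_ofPred_eq] at hS
  let y₀ : Y := Classical.arbitrary Y
  obtain ⟨M, hM0, hM⟩ : ∃ M : ℝ, 0 ≤ M ∧ ∀ p ∈ s, ∀ y, |p.1 y| ≤ M :=
    ⟨∑ p ∈ s, ‖p.1‖, Finset.sum_nonneg fun _ _ => norm_nonneg _, fun p hp y =>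
      (p.1.norm_coe_le_norm y).trans
        (Finset.single_le_sum (f := fun p => ‖p.1‖) (fun _ _ => norm_nonneg _) hp)⟩
  obtain ⟨B, hB0, hB⟩ : ∃ B : ℝ, 0 < B ∧ ∀ e ∈ S, ‖e‖ ≤ B :=
    ⟨∑ e ∈ S, ‖e‖ + 1, by positivity, fun e he =>
      (Finset.single_le_sum (f := fun e => ‖e‖) (fun _ _ => norm_nonneg _) he).trans (by linarith)⟩
  let A : Set H := S ∪ ⋃ p ∈ s, (p.2⁻¹ : H ≃ₗᵢ[ℝ] H) '' S
  let W : Submodule ℝ H := Submodule.span ℝ A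
  have hA : A.Finite :=
    S.finite_toSet.union (s.finite_toSet.biUnion fun p _ => S.finite_toSet.image _)
  have : FiniteDimensional ℝ W := FiniteDimensional.span_of_finite ℝ hA
  have hSW : ∀ e ∈ S, e ∈ W := fun e he => Submodule.subset_span (Or.inl he)
  have hgSW : ∀ p ∈ s, ∀ e ∈ S, (p.2⁻¹ : H ≃ₗᵢ[ℝ] H) e ∈ W := fun p hp e he =>
    Submodule.subset_span (Or.inr (Set.mem_biUnion hp (Set.mem_image_of_mem _ he)))
  choose k hk using fun p : C(Y, ℝ) × (H ≃ₗᵢ[ℝ] H) => exists_unitary_eq_on W p.2⁻¹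
  let L : ℝ := 4 * M * B ^ 2 / δ ^ 2
  have hL : 0 ≤ L := by positivity
  obtain ⟨n, hn⟩ := exists_nat_gt (Fintype.card s * (4 * (L * 2) ^ 2) / (1 / 4) ^ 2 : ℝ)
  have hn0 : (0 : ℝ) < n := lt_of_le_of_lt (by positivity) hn
  have hcard : (Fintype.card s * (4 * (L * 2) ^ 2 / n) : ℝ) ≤ (1 / 4) ^ 2 := by
    rw [div_lt_iff₀ (by norm_num)] at hn
    rw [← mul_div_assoc, div_le_iff₀ hn0]
    linarith
  obtain ⟨ρ, hρdiag, hρ⟩ := exists_pi_unitary_hom hinf W (n := n) (by exact_mod_cast hn0)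
  obtain ⟨u, hu⟩ := exists_forall_abs_translate_sub_le (n := n) (by exact_mod_cast hn0)
    (fun (p : s) u => p.1.1 (ρ u • y₀)) (fun p => (k p)⁻¹) (η := 1 / 4) (ε := 1 / 4) (R := 2) hL
    (by norm_num) dist_unitary_le_two (fun p u v => by
      have hsplit : ρ u • y₀ = ρ (u * v⁻¹) • ρ v • y₀ := by
        rw [← mul_smul, ← map_mul, inv_mul_cancel_right]
      set D : ℝ := (∑ j, dist (u j) (v j)) / n with hD
      have hD0 : 0 ≤ D := by positivity
      by_cases hsmall : 2 * D * B ^ 2 < δ ^ 2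
      · have hlt := hS (ρ (u * v⁻¹)) (fun e he => by
          refine lt_of_pow_lt_pow_left₀ 2 hδ.le (lt_of_le_of_lt ?_ hsmall)
          refine (hρ u v ⟨e, hSW e he⟩).trans ?_
          gcongr
          exact hB e he) p p.2 (ρ v • y₀)
        rw [hsplit]
        have : 0 ≤ L * D := mul_nonneg hL hD0
        linarith
      · have h1 : |p.1.1 (ρ u • y₀) - p.1.1 (ρ v • y₀)| ≤ 2 * M :=
          (abs_sub _ _).trans (by linarith [hM p p.2 (ρ u • y₀), hM p p.2 (ρ v • y₀)])
        have h2 : 2 * M ≤ L * D := by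
          have : L * D = 2 * M * (2 * D * B ^ 2 / δ ^ 2) := by simp only [L]; ring
          rw [this]
          refine le_mul_of_one_le_right (by positivity) ?_
          rw [one_le_div (by positivity)]
          exact not_lt.1 hsmall
        linarith) hcard
  refine ⟨ρ u • y₀, fun p hp => ?_⟩
  have h1 := hu ⟨p, hp⟩
  have h2 := hS (p.2 * ρ fun _ => k p) (fun e he => by
    have h : (ρ fun _ => k p) e = (p.2⁻¹ : H ≃ₗᵢ[ℝ] H) e :=
      (hρdiag (k p) ⟨e, hSW e he⟩).trans (hk p ⟨e, hSW e he⟩ (hgSW p hp e he))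
    rw [LinearIsometryEquiv.coe_mul, Function.comp_apply, h, ← Function.comp_apply (f := p.2),
      ← LinearIsometryEquiv.coe_mul, mul_inv_cancel]
    simpa using hδ) p hp (ρ (fun j => (k p)⁻¹ * u j) • y₀)
  have h3 : (p.2 * ρ fun _ => k p) • ρ (fun j => (k p)⁻¹ * u j) • y₀ = p.2 • ρ u • y₀ := by
    rw [mul_smul, ← mul_smul (ρ fun _ => k p), ← map_mul]
    congr 3
    ext1 j
    simp
  rw [h3] at h2
  have h4 := abs_le.1 h1
  have h5 := abs_lt.1 h2
  dsimp only at h4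
  exact abs_le.2 ⟨by linarith, by linarith⟩

end FixedPoint

/-- Gromov–Milman: the group of surjective linear isometries of a separable
infinite-dimensional real Hilbert space, with the strong operator topology, is extremely
amenable. -/
theorem gromov_milman_unitary_extremelyAmenable
    (H : Type*) [NormedAddCommGroup H] [InnerProductSpace ℝ H] [CompleteSpace H]
    [TopologicalSpace.SeparableSpace H] (hinf : ¬ FiniteDimensional ℝ H) :
    @ExtremelyAmenable (H ≃ₗᵢ[ℝ] H) _ (linearIsoPointwiseTopology H) := by
  let _ := linearIsoPointwiseTopology H
  intro Y _ _ _ _ _ hY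
  exact exists_fixedPoint_of_finite_almost_invariant (exists_almost_invariant_point hinf hY)
end

section
/- The class of finite metric spaces has the extension property: for every finite metric space A there exist a finite metric space B and an isometric embedding i : A → B such that every partial isometry of A (i.e., every bijective distance-preserving map φ : P → Q between subsets P, Q ⊆ A) extends to a bijective self-isometry ψ of B, in the sense that ψ(i(p)) = i(φ(p)) for all p ∈ P. -/
open Set

/-- A bundled finite metric space. -/
structure FinMetricSpace : Type 1 where
  carrier : Type
  [metric : MetricSpace carrier]
  [fin : Finite carrier]

attribute [instance] FinMetricSpace.metric FinMetricSpace.fin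

/-- `IsWalk e n r u v`: there is a walk with `n` edges and total length `r` from `u` to `v` in the
edge-labelled graph `e`, where `u` and `v` are joined by an edge of length `e u v` if
`0 < e u v`. -/
inductive IsWalk {B : Type*} (e : B → B → ℝ) : ℕ → ℝ → B → B → Prop
  | nil (u : B) : IsWalk e 0 0 u u
  | cons {n : ℕ} {r : ℝ} {u v w : B} (h : 0 < e u v) (p : IsWalk e n r v w) :
      IsWalk e (n + 1) (e u v + r) u w

namespace IsWalk

variable {B : Type*} {e : B → B → ℝ}

theorem single {u v : B} (h : 0 < e u v) : IsWalk e 1 (e u v) u v := by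
  simpa using cons h (nil v)

theorem trans {m n : ℕ} {r s : ℝ} {u v w : B} (p : IsWalk e m r u v) (q : IsWalk e n s v w) :
    IsWalk e (m + n) (r + s) u w := by
  induction p with
  | nil u => simpa using q
  | cons h p ih =>
    have hcons := cons h (ih q)
    rwa [← add_assoc, Nat.add_right_comm] at hcons

theorem symm (he : ∀ x y, e x y = e y x) {n : ℕ} {r : ℝ} {u v : B} (p : IsWalk e n r u v) :
    IsWalk e n r v u := by
  induction p with
  | nil u => exact nil u
  | cons h p ih =>
    rw [add_comm (e _ _), he]
    exact ih.trans (single (he _ _ ▸ h))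

theorem map {C : Type*} {e' : C → C → ℝ} (θ : B → C)
    (h : ∀ x y, 0 < e x y → e' (θ x) (θ y) = e x y) {n : ℕ} {r : ℝ} {u v : B}
    (p : IsWalk e n r u v) : IsWalk e' n r (θ u) (θ v) := by
  induction p with
  | nil u => exact nil _
  | cons huv p ih =>
    rw [← h _ _ huv]
    exact cons (by rwa [h _ _ huv]) ih

theorem mul_le {δ : ℝ} (hδ : ∀ x y, 0 < e x y → δ ≤ e x y) {n : ℕ} {r : ℝ} {u v : B}
    (p : IsWalk e n r u v) : n * δ ≤ r := by
  induction p with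
  | nil u => simp
  | cons h p ih =>
    push_cast
    linarith [hδ _ _ h]

theorem exists_fun {n : ℕ} {r : ℝ} {u v : B} (p : IsWalk e n r u v) :
    ∃ f : ℕ → B, f 0 = u ∧ f n = v ∧ (∀ k < n, 0 < e (f k) (f (k + 1))) ∧
      ∑ k ∈ Finset.range n, e (f k) (f (k + 1)) = r := by
  induction p with
  | nil u => exact ⟨fun _ => u, by simp⟩
  | @cons n r u v w h p ih =>
    obtain ⟨f, h0, hn, hf, hs⟩ := ih
    refine ⟨fun k => Nat.casesOn k u f, rfl, hn, ?_, ?_⟩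
    · rintro (_ | k) hk
      · simpa [h0] using h
      · exact hf k (by omega)
    · rw [Finset.sum_range_succ', add_comm, ← hs]
      simp [h0]

theorem of_fun (f : ℕ → B) {a b : ℕ} (hab : a ≤ b)
    (hf : ∀ k, k < b → 0 < e (f k) (f (k + 1))) :
    IsWalk e (b - a) (∑ k ∈ Finset.Ico a b, e (f k) (f (k + 1))) (f a) (f b) := by
  induction b, hab using Nat.le_induction with
  | base => simpa using nil (f a)
  | succ b hab ih =>
    rw [Finset.sum_Ico_succ_top hab, Nat.succ_sub hab]
    exact (ih fun k hk => hf k (by omega)).trans (single (hf b (by omega)))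

end IsWalk

/-- Every edge is at most as long as any walk with at most `n` edges joining its ends. -/
def MetricUpTo {B : Type*} (e : B → B → ℝ) (n : ℕ) : Prop :=
  ∀ m ≤ n, ∀ r u v, IsWalk e m r u v → e u v ≤ r

/-- A walk with `n + 1` edges which is shorter than the edge joining its ends. -/
def IsBadWalk {B : Type*} (e : B → B → ℝ) (n : ℕ) (w : Fin (n + 2) → B) : Prop :=
  (∀ k : Fin (n + 1), 0 < e (w k.castSucc) (w k.succ)) ∧
    ∑ k : Fin (n + 1), e (w k.castSucc) (w k.succ) < e (w 0) (w (Fin.last (n + 1)))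

theorem isBadWalk_fun {B : Type*} {e : B → B → ℝ} {n : ℕ} {f : ℕ → B} :
    IsBadWalk e n (fun k : Fin (n + 2) => f k) ↔ (∀ k < n + 1, 0 < e (f k) (f (k + 1))) ∧
      ∑ k ∈ Finset.range (n + 1), e (f k) (f (k + 1)) < e (f 0) (f (n + 1)) := by
  simp only [IsBadWalk, Fin.val_castSucc, Fin.val_succ, Fin.val_zero, Fin.val_last,
    Fin.sum_univ_eq_sum_range (fun k => e (f k) (f (k + 1))) (n + 1)]
  rw [Fin.forall_iff]

theorem exists_fun_eq {B : Type*} {n : ℕ} (w : Fin (n + 2) → B) :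
    ∃ f : ℕ → B, w = fun k : Fin (n + 2) => f k := by
  refine ⟨fun k => w ⟨min k (n + 1), by omega⟩, ?_⟩
  ext k
  congr 1
  ext
  simp
  omega

theorem IsBadWalk.chord {B : Type*} {e : B → B → ℝ} {n : ℕ} {f : ℕ → B}
    (hn : MetricUpTo e n) (hf : IsBadWalk e n (fun k : Fin (n + 2) => f k)) {a b : ℕ} (hab : a < b)
    (hb : b ≤ n + 1) (h : 0 < e (f a) (f b)) : b = a + 1 ∨ (a = 0 ∧ b = n + 1) := by
  rw [isBadWalk_fun] at hf
  obtain ⟨hf, hs⟩ := hf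
  by_contra! hcon
  have h1 := IsWalk.of_fun (e := e) f (Nat.zero_le a) fun k hk => hf k (by omega)
  have h2 := IsWalk.of_fun (e := e) f hab.le fun k hk => hf k (by omega)
  have h3 := IsWalk.of_fun (e := e) f hb fun k hk => hf k (by omega)
  have h4 := hn _ (by omega) _ _ _ ((h1.trans (IsWalk.single h)).trans h3)
  have h5 := hn _ (by omega) _ _ _ h2
  rw [Finset.range_eq_Ico, ← Finset.sum_Ico_consecutive _ (Nat.zero_le a) (by omega : a ≤ n + 1),
    ← Finset.sum_Ico_consecutive _ hab.le hb] at hs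
  linarith

theorem IsBadWalk.comp_iff {B : Type*} {e : B → B → ℝ} {n : ℕ} {w : Fin (n + 2) → B}
    {θ : B → B} (h : ∀ x y, e (θ x) (θ y) = e x y) :
    IsBadWalk e n (θ ∘ w) ↔ IsBadWalk e n w := by
  simp [IsBadWalk, h]

/-- The edge-labelled graph `e` on `B`, with edge lengths in `[δ, M]`, extends `A` via `i`, and all
partial isometries of `A` extend to automorphisms of `e`. -/
structure IsExtension (A : Type*) [MetricSpace A] {B : Type*} (e : B → B → ℝ) (i : A → B)
    (δ M : ℝ) : Prop where
  symm : ∀ x y, e x y = e y x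
  self : ∀ x, e x x = 0
  nonneg : ∀ x y, 0 ≤ e x y
  le_of_pos : ∀ x y, 0 < e x y → δ ≤ e x y
  le : ∀ x y, e x y ≤ M
  map_eq : ∀ x y, e (i x) (i y) = dist x y
  extend : ∀ (P : Set A) (φ : A → A), (∀ p ∈ P, ∀ q ∈ P, dist (φ p) (φ q) = dist p q) →
    ∃ θ : B ≃ B, (∀ x y, e (θ x) (θ y) = e x y) ∧ ∀ p ∈ P, θ (i p) = i (φ p)

theorem exists_perm_eqOn {A : Type*} [Finite A] {P : Set A} {φ : A → A} (h : InjOn φ P) :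
    ∃ σ : Equiv.Perm A, EqOn σ φ P := by
  classical
  have := Fintype.ofFinite A
  refine ⟨(Equiv.Set.imageOfInjOn φ P h).extendSubtype (p := (· ∈ P))
    (q := (· ∈ Set.image φ P)), ?_⟩
  intro p hp
  rw [Equiv.extendSubtype_apply_of_mem _ _ hp]
  rfl

theorem exists_isExtension.{u} (A : Type u) [MetricSpace A] [Finite A] :
    ∃ (B : Type u) (_ : Finite B) (e : B → B → ℝ) (i : A → B) (δ M : ℝ), 0 < δ ∧
      IsExtension A e i δ M := by
  classical
  let D := Set.range fun p : A × A => dist p.1 p.2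
  have : Fintype D := Fintype.ofFinite D
  let G := D → ZMod 3
  let code : A → A → G := fun x y => Pi.single ⟨dist x y, (x, y), rfl⟩ 1
  have code_congr {x y x' y' : A} (h : dist x y = dist x' y') : code x y = code x' y' := by
    simp only [code, h]
  have code_comm (x y : A) : code x y = code y x := code_congr (dist_comm x y)
  let len : G → ℝ := fun g => ∑ s : D, if g s = 0 then 0 else (s : ℝ)
  have len_nonneg (g : G) : 0 ≤ len g := by
    refine Finset.sum_nonneg fun s _ => ?_
    obtain ⟨_, p, rfl⟩ := s
    split_ifs
    · exact le_rfl
    · exact dist_nonneg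
  have len_code (x y : A) : len (code x y + code x y) = dist x y := by
    have h2 : (1 + 1 : ZMod 3) ≠ 0 := by decide
    simp only [len, code]
    rw [Finset.sum_eq_single ⟨dist x y, (x, y), rfl⟩]
    · rw [if_neg]
      rw [Pi.add_apply, Pi.single_eq_same]
      exact h2
    · intro s _ hs
      rw [if_pos]
      rw [Pi.add_apply, Pi.single_eq_of_ne hs, add_zero]
    · simp
  let B := A × (A → G)
  let e : B → B → ℝ := fun x y => if x.1 = y.1 then 0 else len (x.2 y.1 + y.2 x.1)
  have e_nonneg (x y : B) : 0 ≤ e x y := by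
    simp only [e]
    split_ifs
    · exact le_rfl
    · exact len_nonneg _
  obtain ⟨M, hM⟩ := (Set.finite_range fun p : B × B => e p.1 p.2).bddAbove
  obtain ⟨δ, hδ, hδ0⟩ : ∃ δ : ℝ, (∀ p : B × B, 0 < e p.1 p.2 → δ ≤ e p.1 p.2) ∧ 0 < δ := by
    have h : ∀ᶠ δ in nhdsWithin (0 : ℝ) (Ioi 0), ∀ p : B × B, 0 < e p.1 p.2 → δ ≤ e p.1 p.2 := by
      refine Filter.eventually_all.2 fun p => ?_
      by_cases hp : 0 < e p.1 p.2
      · filter_upwards [Ioo_mem_nhdsGT hp] with δ hδ _ using hδ.2.le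
      · simp [hp]
    exact (h.and self_mem_nhdsWithin).exists
  refine ⟨B, inferInstance, e, fun x => (x, code x), δ, M, hδ0, ?_, ?_, e_nonneg,
    fun x y => hδ (x, y), fun x y => hM ⟨(x, y), rfl⟩, ?_, ?_⟩
  · intro x y
    simp only [e, eq_comm (a := x.1), add_comm (x.2 y.1)]
  · simp [e]
  · intro x y
    by_cases h : x = y
    · simp [e, h]
    · simp only [e, h, if_false, code_comm y x, len_code]
  · intro P φ hφ
    obtain ⟨σ, hσ⟩ := exists_perm_eqOn (P := P) (φ := φ) fun p hp q hq h => by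
      rw [← dist_eq_zero, ← hφ p hp q hq, h, dist_self]
    let a : A → ZMod 3 := fun x => if x ∈ P then 1 else 0
    let c : A → A → G := fun x y => (a x - a y) • (code (σ x) (σ y) - code x y)
    have c_anti (x y : A) : c x y + c y x = 0 := by
      simp only [c, code_comm y x, code_comm (σ y) (σ x)]
      module
    refine ⟨Equiv.prodShear σ fun x => (Equiv.addRight (c x)).trans
      (Equiv.arrowCongr σ (Equiv.refl G)), ?_, ?_⟩
    · rintro ⟨x, χ⟩ ⟨y, χ'⟩
      have h : χ y + c x y + (χ' x + c y x) = χ y + χ' x := by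
        rw [add_add_add_comm, c_anti, add_zero]
      simp [e, Equiv.prodShear, Equiv.arrowCongr, h]
    · intro p hp
      refine Prod.ext (hσ hp) ?_
      funext z
      obtain ⟨y, rfl⟩ := σ.surjective z
      have key : code p y + c p y = code (φ p) (σ y) := by
        rw [← hσ hp]
        by_cases hy : y ∈ P
        · have : code (σ p) (σ y) = code p y := by
            rw [hσ hp, hσ hy]
            exact code_congr (hφ p hp y hy)
          simp [c, this]
        · simp [c, a, hp, hy]
      simpa [Equiv.prodShear, Equiv.arrowCongr] using key

section Lift

variable {A B : Type*} [MetricSpace A] {e : B → B → ℝ} {i : A → B} {δ M : ℝ} {n : ℕ}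

theorem IsExtension.not_three_of_lt (hE : IsExtension A e i δ M) (hn : MetricUpTo e n)
    {f : ℕ → B} (hf : IsBadWalk e n (fun k : Fin (n + 2) => f k))
    {x y z : A} (hxy : x ≠ y) (hxz : x ≠ z)
    (hyz : y ≠ z) {a b c : ℕ} (hab : a < b) (hbc : b < c) (hc : c ≤ n + 1) (hx : f a = i x)
    (hy : f b = i y) (hz : f c = i z) : False := by
  have h1 := hf.chord hn hab (by omega) (by rw [hx, hy, hE.map_eq]; exact dist_pos.2 hxy)
  have h2 := hf.chord hn hbc (by omega) (by rw [hy, hz, hE.map_eq]; exact dist_pos.2 hyz)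
  have h3 := hf.chord hn (hab.trans hbc) hc
    (by rw [hx, hz, hE.map_eq]; exact dist_pos.2 hxz)
  obtain rfl : a = 0 := by omega
  obtain rfl : b = 1 := by omega
  obtain rfl : c = 2 := by omega
  obtain rfl : n = 1 := by omega
  have h := (isBadWalk_fun.1 hf).2
  simp only [Finset.sum_range_succ, Finset.sum_range_zero, zero_add, Nat.reduceAdd, hx, hy, hz,
    hE.map_eq] at h
  linarith [dist_triangle x y z]

theorem IsExtension.not_three (hE : IsExtension A e i δ M) (hn : MetricUpTo e n)
    {w : Fin (n + 2) → B} (hw : IsBadWalk e n w)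
    {x y z : A} (hxy : x ≠ y) (hxz : x ≠ z)
    (hyz : y ≠ z) (hx : i x ∈ range w) (hy : i y ∈ range w) (hz : i z ∈ range w) : False := by
  obtain ⟨f, rfl⟩ := exists_fun_eq w
  obtain ⟨a, hx⟩ := hx
  obtain ⟨b, hy⟩ := hy
  obtain ⟨c, hz⟩ := hz
  have inj {x y : A} (hxy : x ≠ y) {a b : ℕ} (hx : f a = i x) (hy : f b = i y) : a ≠ b := by
    rintro rfl
    have h := hE.map_eq x y
    rw [← hx, ← hy, hE.self] at h
    exact hxy (dist_eq_zero.1 h.symm)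
  have ha : (a : ℕ) ≤ n + 1 := by omega
  have hb : (b : ℕ) ≤ n + 1 := by omega
  have hc : (c : ℕ) ≤ n + 1 := by omega
  rcases lt_or_gt_of_ne (inj hxy hx hy) with h1 | h1 <;>
  rcases lt_or_gt_of_ne (inj hxz hx hz) with h2 | h2 <;>
  rcases lt_or_gt_of_ne (inj hyz hy hz) with h3 | h3
  · exact hE.not_three_of_lt hn hw hxy hxz hyz h1 h3 hc hx hy hz
  · exact hE.not_three_of_lt hn hw hxz hxy hyz.symm h2 h3 hb hx hz hy
  · omega
  · exact hE.not_three_of_lt hn hw hxz.symm hyz.symm hxy h2 h1 hb hz hx hy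
  · exact hE.not_three_of_lt hn hw hxy.symm hyz hxz h1 h2 hc hy hx hz
  · omega
  · exact hE.not_three_of_lt hn hw hyz hxy.symm hxz.symm h3 h2 ha hy hz hx
  · exact hE.not_three_of_lt hn hw hyz.symm hxz.symm hxy.symm h3 h1 ha hz hy hx

open Classical in
/-- The indicator of the edges having the length of the edge closing up the walk `w`. -/
noncomputable def longEdge (e : B → B → ℝ) (w : Fin (n + 2) → B) (r : ℝ) : ZMod 2 :=
  if r = e (w 0) (w (Fin.last (n + 1))) then 1 else 0

theorem IsExtension.exists_valuation (hE : IsExtension A e i δ M) (hn : MetricUpTo e n)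
    (w : Fin (n + 2) → B) : ∃ c : A → ZMod 2,
      (∀ x, ¬(IsBadWalk e n w ∧ i x ∈ range w) → c x = 0) ∧
      (IsBadWalk e n w → ∀ x y, i x ∈ range w → i y ∈ range w →
        c x + c y = longEdge e w (dist x y)) := by
  classical
  by_cases h : IsBadWalk e n w ∧ ∃ x, i x ∈ range w
  · obtain ⟨hw, x₀, hx₀⟩ := h
    have hpos : e (w 0) (w (Fin.last (n + 1))) ≠ 0 := by
      have := Finset.sum_nonneg fun k (_ : k ∈ Finset.univ) => (hw.1 k).le
      exact (this.trans_lt hw.2).ne'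
    have h0 : longEdge e w 0 = 0 := by simp [longEdge, hpos.symm]
    refine ⟨fun x => if i x ∈ range w then longEdge e w (dist x₀ x) else 0,
      fun x hx => if_neg fun h => hx ⟨hw, h⟩, fun _ x y hx hy => ?_⟩
    simp only [hx, hy, if_true]
    by_cases hxy : x = y
    · rw [hxy, dist_self, h0, CharTwo.add_self_eq_zero]
    by_cases h1 : x₀ = x
    · rw [← h1, dist_self, h0, zero_add]
    by_cases h2 : x₀ = y
    · rw [← h2, dist_self, h0, add_zero, dist_comm]
    exact (hE.not_three hn hw h1 h2 hxy hx₀ hx hy).elim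
  · exact ⟨0, fun _ _ => rfl, fun hw x _ hx => (h ⟨hw, x, hx⟩).elim⟩

/-- Compatibility of two vertices of the cover of `e` which unwinds bad walks. -/
def Compatible (e : B → B → ℝ) (n : ℕ) (x y : B × ((Fin (n + 2) → B) → ZMod 2)) : Prop :=
  ∀ w, IsBadWalk e n w → x.1 ∈ range w → y.1 ∈ range w →
    x.2 w + y.2 w = longEdge e w (e x.1 y.1)

open Classical in
/-- The cover of `e` which unwinds bad walks. -/
noncomputable def badWalkCover (e : B → B → ℝ) (n : ℕ)
    (x y : B × ((Fin (n + 2) → B) → ZMod 2)) : ℝ :=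
  if Compatible e n x y then e x.1 y.1 else 0

theorem badWalkCover_eq_of_pos {x y : B × ((Fin (n + 2) → B) → ZMod 2)}
    (h : 0 < badWalkCover e n x y) :
    Compatible e n x y ∧ badWalkCover e n x y = e x.1 y.1 := by
  unfold badWalkCover at h ⊢
  split_ifs at h ⊢ with hc
  · exact ⟨hc, rfl⟩
  · exact (lt_irrefl _ h).elim

theorem MetricUpTo.cover (he : ∀ x y, 0 ≤ e x y) (hn : MetricUpTo e n) :
    MetricUpTo (badWalkCover e n) (n + 1) := by
  intro m hm r u v p
  by_cases hpos : 0 < badWalkCover e n u v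
  swap
  · exact (not_lt.1 hpos).trans
      ((by positivity : (0 : ℝ) ≤ m * 0).trans (p.mul_le fun x y h => h.le))
  obtain ⟨hc, heq⟩ := badWalkCover_eq_of_pos hpos
  rw [heq]
  have hproj := p.map (e' := e) Prod.fst fun x y h => (badWalkCover_eq_of_pos h).2.symm
  rcases Nat.lt_or_ge n m with hnm | hnm
  swap
  · exact hn m hnm _ _ _ hproj
  obtain rfl : m = n + 1 := by omega
  by_contra! hlt
  obtain ⟨f, rfl, rfl, hf, rfl⟩ := p.exists_fun
  have hfe : ∀ k < n + 1, badWalkCover e n (f k) (f (k + 1)) = e (f k).1 (f (k + 1)).1 :=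
    fun k hk => (badWalkCover_eq_of_pos (hf k hk)).2
  rw [Finset.sum_congr rfl fun k hk => hfe k (Finset.mem_range.1 hk)] at hlt
  let w : Fin (n + 2) → B := fun k => (f k).1
  have hw : IsBadWalk e n w :=
    isBadWalk_fun (f := fun k => (f k).1).2 ⟨fun k hk => hfe k hk ▸ hf k hk, hlt⟩
  have hmem : ∀ k ≤ n + 1, (f k).1 ∈ range w := fun k hk => ⟨⟨k, by omega⟩, rfl⟩
  have hconst : ∀ k ≤ n + 1, (f k).2 w = (f 0).2 w := by
    intro k
    induction k with
    | zero => exact fun _ => rfl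
    | succ k ih =>
      intro hk
      have h1 := (badWalkCover_eq_of_pos (hf k (by omega))).1 w hw (hmem _ (by omega)) (hmem _ hk)
      have h2 : e (f k).1 (f (k + 1)).1 < e (f 0).1 (f (n + 1)).1 :=
        (Finset.single_le_sum (f := fun k => e (f k).1 (f (k + 1)).1) (fun _ _ => he _ _)
          (Finset.mem_range.2 hk)).trans_lt hlt
      rw [longEdge, if_neg (by simpa [w] using h2.ne), CharTwo.add_eq_zero] at h1
      rw [← h1, ih (by omega)]
  have h1 := hc w hw (hmem _ (by omega)) (hmem _ le_rfl)
  rw [hconst _ le_rfl, CharTwo.add_self_eq_zero, longEdge, if_pos (by simp [w])] at h1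
  exact zero_ne_one h1

theorem IsExtension.cover (hE : IsExtension A e i δ M) (hM : 0 ≤ M) (hn : MetricUpTo e n) :
    ∃ i' : A → B × ((Fin (n + 2) → B) → ZMod 2), IsExtension A (badWalkCover e n) i' δ M := by
  classical
  choose c hc0 hc using hE.exists_valuation hn
  refine ⟨fun x => (i x, fun w => c w x), ?_, ?_, ?_, ?_, ?_, ?_, ?_⟩
  · intro x y
    have : Compatible e n x y ↔ Compatible e n y x := by
      simp only [Compatible, hE.symm y.1, add_comm (y.2 _)]
      exact forall₂_congr fun _ _ => forall_comm
    simp only [badWalkCover, this, hE.symm x.1]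
  · simp [badWalkCover, hE.self]
  · intro x y
    unfold badWalkCover
    split_ifs
    exacts [hE.nonneg _ _, le_rfl]
  · intro x y h
    obtain ⟨-, heq⟩ := badWalkCover_eq_of_pos h
    rw [heq] at h ⊢
    exact hE.le_of_pos _ _ h
  · intro x y
    unfold badWalkCover
    split_ifs
    exacts [hE.le _ _, hM]
  · intro x y
    rw [badWalkCover, if_pos, hE.map_eq]
    intro w hw hx hy
    rw [hE.map_eq]
    exact hc w hw x y hx hy
  · intro P φ hφ
    obtain ⟨θ, hθ, hext⟩ := hE.extend P φ hφ
    have long_comp (w : Fin (n + 2) → B) (r : ℝ) : longEdge e (θ ∘ w) r = longEdge e w r := by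
      simp [longEdge, hθ]
    have mem_comp (w : Fin (n + 2) → B) (x : B) : θ x ∈ range (θ ∘ w) ↔ x ∈ range w := by
      simp
    have hflip (w : Fin (n + 2) → B) : ∃ b : ZMod 2, ∀ p ∈ P, i p ∈ range w →
        c (θ ∘ w) (φ p) = c w p + b := by
      by_cases hw : IsBadWalk e n w
      swap
      · refine ⟨0, fun p _ _ => ?_⟩
        rw [hc0 _ _ fun h => hw h.1, hc0 _ _ fun h => hw ((IsBadWalk.comp_iff hθ).1 h.1), add_zero]
      by_cases hp : ∃ p ∈ P, i p ∈ range w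
      swap
      · exact ⟨0, fun p hp' h => (hp ⟨p, hp', h⟩).elim⟩
      obtain ⟨q, hq, hqw⟩ := hp
      refine ⟨c (θ ∘ w) (φ q) + c w q, fun p hp hpw => ?_⟩
      have h1 := hc w hw p q hpw hqw
      have h2 := hc (θ ∘ w) ((IsBadWalk.comp_iff hθ).2 hw) (φ p) (φ q)
        (by rwa [← hext p hp, mem_comp]) (by rwa [← hext q hq, mem_comp])
      rw [long_comp, hφ p hp q hq, ← h1] at h2
      rw [← add_left_inj (c (θ ∘ w) (φ q)), h2]
      linear_combination -(CharTwo.add_self_eq_zero (c (θ ∘ w) (φ q)))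
    choose b hb using hflip
    let t : B → (Fin (n + 2) → B) → ZMod 2 := fun x w => if x ∈ range w then b w else 0
    let E : (Fin (n + 2) → B) ≃ (Fin (n + 2) → B) := Equiv.arrowCongr (Equiv.refl _) θ
    let Θ : B × ((Fin (n + 2) → B) → ZMod 2) ≃ B × ((Fin (n + 2) → B) → ZMod 2) :=
      Equiv.prodShear θ fun x => (Equiv.addRight (t x)).trans
        (Equiv.arrowCongr E (Equiv.refl _))
    have hE_apply (w : Fin (n + 2) → B) : E w = θ ∘ w := by
      ext
      simp [E]
    have Θ_fst (x) : (Θ x).1 = θ x.1 := rfl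
    have Θ_snd (x) (w) : (Θ x).2 (θ ∘ w) = x.2 w + t x.1 w := by
      rw [← hE_apply]
      simp [Θ, Equiv.prodShear, Equiv.arrowCongr]
    have forall_comp (p : (Fin (n + 2) → B) → Prop) : (∀ w, p w) ↔ ∀ w, p (θ ∘ w) := by
      simp only [← hE_apply]
      exact E.forall_congr_right.symm
    refine ⟨Θ, fun x y => ?_, fun p hp => ?_⟩
    · have : Compatible e n (Θ x) (Θ y) ↔ Compatible e n x y := by
        rw [Compatible, forall_comp]
        simp only [Θ_fst, Θ_snd, hθ, long_comp, mem_comp, IsBadWalk.comp_iff hθ]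
        refine forall₄_congr fun w hw hx hy => ?_
        simp only [t, hx, hy, if_true]
        rw [add_add_add_comm, CharTwo.add_self_eq_zero, add_zero]
      simp only [badWalkCover, this, Θ_fst, hθ]
    · refine Prod.ext (hext p hp) ?_
      rw [funext_iff, forall_comp]
      intro w
      rw [Θ_snd]
      by_cases hw : i p ∈ range w
      · simp only [t, hw, if_true]
        exact (hb w p hp hw).symm
      · have hw' : i (φ p) ∉ range (θ ∘ w) := by rwa [← hext p hp, mem_comp]
        simp only [t, hw, if_false, add_zero]
        rw [hc0 _ _ fun h => hw h.2, hc0 _ _ fun h => hw' h.2]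

end Lift

theorem exists_isExtension_metricUpTo.{u} (A : Type u) [MetricSpace A] [Finite A] :
    ∃ δ M : ℝ, 0 < δ ∧ δ ≤ M ∧ ∀ n, ∃ (B : Type u) (_ : Finite B) (e : B → B → ℝ) (i : A → B),
      IsExtension A e i δ M ∧ MetricUpTo e n := by
  obtain ⟨B, _, e, i, δ, M, hδ, hE⟩ := exists_isExtension A
  have hE' : IsExtension A e i δ (max δ M) :=
    { hE with le := fun x y => (hE.le x y).trans (le_max_right _ _) }
  refine ⟨δ, max δ M, hδ, le_max_left _ _, fun n => ?_⟩
  induction n with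
  | zero =>
    refine ⟨B, inferInstance, e, i, hE', ?_⟩
    intro m hm r u v p
    obtain rfl : m = 0 := by omega
    cases p
    exact (hE.self u).le
  | succ n ih =>
    obtain ⟨B, _, e, i, hE, hn⟩ := ih
    obtain ⟨i', hi'⟩ := hE.cover (hδ.le.trans (le_max_left _ _)) hn
    exact ⟨_, inferInstance, _, i', hi', hn.cover hE.nonneg⟩

/-- The lengths of walks from `u` to `v`, together with the upper bound `M`. -/
def walkLengths {B : Type*} (e : B → B → ℝ) (M : ℝ) (u v : B) : Set ℝ :=
  insert M {r | ∃ n, IsWalk e n r u v}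

theorem exists_metricSpace {B : Type*} {e : B → B → ℝ} {δ M : ℝ} (hδ : 0 < δ) (hδM : δ ≤ M)
    (symm : ∀ x y, e x y = e y x) (le_of_pos : ∀ x y, 0 < e x y → δ ≤ e x y)
    (le : ∀ x y, e x y ≤ M) (hmet : ∀ n, MetricUpTo e n) :
    ∃ m : MetricSpace B, (∀ x y, 0 < e x y → m.dist x y = e x y) ∧
      ∀ θ : B ≃ B, (∀ x y, e (θ x) (θ y) = e x y) → ∀ x y, m.dist (θ x) (θ y) = m.dist x y := by
  let S := walkLengths e M
  have ne (u v : B) : (S u v).Nonempty := ⟨M, mem_insert _ _⟩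
  have nonneg (u v : B) : ∀ r ∈ S u v, 0 ≤ r := by
    rintro r (rfl | ⟨n, p⟩)
    · exact hδ.le.trans hδM
    · exact le_trans (by positivity) (p.mul_le le_of_pos)
  have bdd (u v : B) : BddBelow (S u v) := ⟨0, nonneg u v⟩
  have S_comm (u v : B) : S u v = S v u :=
    congrArg (insert M) <| Set.ext fun r => exists_congr fun n =>
      ⟨fun p => p.symm symm, fun p => p.symm symm⟩
  refine ⟨{ dist := fun u v => sInf (S u v), dist_self := ?_, dist_comm := ?_,
            dist_triangle := ?_, eq_of_dist_eq_zero := ?_ }, ?_, ?_⟩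
  · intro u
    exact le_antisymm (csInf_le (bdd u u) (Or.inr ⟨0, .nil u⟩)) (le_csInf (ne u u) (nonneg u u))
  · intro u v
    exact congrArg sInf (S_comm u v)
  · intro u v w
    have key : ∀ r ∈ S u v, ∀ s ∈ S v w, sInf (S u w) ≤ r + s := by
      intro r hr s hs
      have hr0 := nonneg _ _ r hr
      have hs0 := nonneg _ _ s hs
      have hM : sInf (S u w) ≤ M := csInf_le (bdd u w) (mem_insert _ _)
      rcases hr with rfl | ⟨m, p⟩
      · linarith
      rcases hs with rfl | ⟨n, q⟩
      · linarith
      exact csInf_le (bdd u w) (Or.inr ⟨_, p.trans q⟩)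
    have h1 : ∀ r ∈ S u v, sInf (S u w) - r ≤ sInf (S v w) := fun r hr =>
      le_csInf (ne v w) fun s hs => by linarith [key r hr s hs]
    have h2 : sInf (S u w) - sInf (S v w) ≤ sInf (S u v) :=
      le_csInf (ne u v) fun r hr => by linarith [h1 r hr]
    change sInf (S u w) ≤ sInf (S u v) + sInf (S v w)
    linarith
  · intro u v (h : sInf (S u v) = 0)
    by_contra huv
    have : δ ≤ sInf (S u v) := by
      refine le_csInf (ne u v) ?_
      rintro r (rfl | ⟨n, p⟩)
      · exact hδM
      · have hn : 1 ≤ n := by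
          rcases n with _ | n
          · cases p
            exact (huv rfl).elim
          · omega
        have hn' : (1 : ℝ) ≤ n := by exact_mod_cast hn
        nlinarith [p.mul_le le_of_pos]
    linarith
  · intro x y h
    refine le_antisymm (csInf_le (bdd x y) (Or.inr ⟨1, .single h⟩)) (le_csInf (ne x y) ?_)
    rintro r (rfl | ⟨n, p⟩)
    · exact le x y
    · exact hmet n n le_rfl _ _ _ p
  · intro θ hθ x y
    change sInf (S (θ x) (θ y)) = sInf (S x y)
    have hθ' (x y : B) : e (θ.symm x) (θ.symm y) = e x y := by
      simpa using (hθ (θ.symm x) (θ.symm y)).symm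
    refine congrArg (fun T => sInf (insert M T)) <| Set.ext fun r => exists_congr fun n =>
      ⟨fun p => ?_, fun p => p.map θ fun x y _ => hθ x y⟩
    simpa using p.map θ.symm fun x y _ => hθ' x y

theorem exists_finMetricSpace (B : Type*) [MetricSpace B] [Finite B] :
    ∃ (C : FinMetricSpace) (g : B ≃ C.carrier), ∀ x y, dist (g x) (g y) = dist x y := by
  obtain ⟨k, ⟨g⟩⟩ := Finite.exists_equiv_fin B
  let : MetricSpace (Fin k) := MetricSpace.induced g.symm g.symm.injective inferInstance
  refine ⟨⟨Fin k⟩, g, fun x y => ?_⟩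
  change dist (g.symm (g x)) (g.symm (g y)) = dist x y
  rw [g.symm_apply_apply, g.symm_apply_apply]

/-- Solecki's theorem: the class of finite metric spaces has the extension property. Every
finite metric space `A` embeds isometrically into a finite metric space `B` in such a way that
every partial isometry of `A` (a bijective distance-preserving map between two subsets of `A`)
extends to a bijective self-isometry of `B`. -/
theorem finiteMetricSpaces_extensionProperty
    (A : Type*) [MetricSpace A] [Finite A] :
    ∃ (B : FinMetricSpace) (i : A → B.carrier), Isometry i ∧
      ∀ (P Q : Set A) (φ : P → Q), Function.Bijective φ →
        (∀ p q : P, dist (φ p : A) (φ q : A) = dist (p : A) (q : A)) →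
        ∃ ψ : B.carrier ≃ᵢ B.carrier, ∀ p : P, ψ (i (p : A)) = i ((φ p : A)) := by
  classical
  obtain ⟨δ, M, hδ, hδM, h⟩ := exists_isExtension_metricUpTo A
  obtain ⟨N, hN⟩ := exists_nat_ge (M / δ)
  obtain ⟨B, _, e, i, hE, hn⟩ := h N
  have hmet (n : ℕ) : MetricUpTo e n := by
    intro m _ r u v p
    rcases le_total m N with hm | hm
    · exact hn m hm r u v p
    · have h1 : M ≤ N * δ := (div_le_iff₀ hδ).1 hN
      have h2 : (N : ℝ) ≤ m := by exact_mod_cast hm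
      have h3 := p.mul_le hE.le_of_pos
      have h4 := hE.le u v
      nlinarith
  obtain ⟨metric, hdist, hiso⟩ := exists_metricSpace hδ hδM hE.symm hE.le_of_pos hE.le hmet
  obtain ⟨C, g, hg⟩ := exists_finMetricSpace B
  refine ⟨C, fun x => g (i x), Isometry.of_dist_eq fun x y => ?_, fun P Q φ _ hφ => ?_⟩
  · rw [hg]
    by_cases hxy : x = y
    · rw [hxy, dist_self, dist_self]
    · refine (hdist _ _ ?_).trans (hE.map_eq x y)
      rw [hE.map_eq]
      exact dist_pos.2 hxy
  · obtain ⟨θ, hθ, hext⟩ := hE.extend P (fun a => if h : a ∈ P then φ ⟨a, h⟩ else a) (by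
      intro p hp q hq
      simpa only [hp, hq, dif_pos] using hφ ⟨p, hp⟩ ⟨q, hq⟩)
    refine ⟨⟨(g.symm.trans θ).trans g, Isometry.of_dist_eq fun x y => ?_⟩, fun p => ?_⟩
    · have h : dist (θ (g.symm x)) (θ (g.symm y)) = dist (g.symm x) (g.symm y) := hiso θ hθ _ _
      rw [← hg, ← hg (g.symm x)] at h
      simpa using h
    · have h := hext p p.2
      simp only [p.2, dif_pos] at h
      change g (θ (g.symm (g (i p)))) = g (i (φ p))
      rw [g.symm_apply_apply, h]
end
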